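/- Let O ⊆ ℝ^d be an open set and let δ, ω be positive Borel measures on O with compact support in O. Then ω is an sbh(O)-balayage of δ (i.e. ∫ u dδ ≤ ∫ u dω for every u subharmonic on O) if and only if there exists a compact set S ⋐ O such that ∫ K_{d−2}(y,x) dδ(y) ≤ ∫ K_{d−2}(y,x) dω(y) for every x ∈ O, with equality for every x ∈ O∖S. -/

import Mathlib

open MeasureTheory Metric Set Filter
open scoped ENNReal Topology OnePoint

noncomputable section

/-- `d`-dimensional Euclidean space. -/
abbrev Euc (d : ℕ) : Type := EuclideanSpace ℝ (Fin d)

/-- A real-valued function is *harmonic on a set* if it is continuous there and satisfies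
the mean value equality over every closed ball contained in the set. -/
def HarmOn {d : ℕ} (h : Euc d → ℝ) (O : Set (Euc d)) : Prop :=
  ContinuousOn h O ∧
    ∀ x : Euc d, ∀ r : ℝ, 0 < r → closedBall x r ⊆ O →
      h x = ⨍ y in closedBall x r, h y ∂volume

/-- An `EReal`-valued function is *subharmonic on a set* if it is upper semicontinuous there,
nowhere `+∞` there, and on every closed ball contained in the set it is dominated by each
continuous function harmonic in the interior that dominates it on the boundary sphere. -/
def SbhOn {d : ℕ} (u : Euc d → EReal) (O : Set (Euc d)) : Prop :=
  UpperSemicontinuousOn u O ∧ (∀ x ∈ O, u x < ⊤) ∧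
    ∀ x : Euc d, ∀ r : ℝ, 0 < r → closedBall x r ⊆ O →
      ∀ h : Euc d → ℝ, ContinuousOn h (closedBall x r) → HarmOn h (ball x r) →
        (∀ y ∈ sphere x r, u y ≤ (h y : EReal)) →
        ∀ y ∈ closedBall x r, u y ≤ (h y : EReal)

/-- The positive part of an extended real number, as a member of `ℝ≥0∞`. -/
def erealPos (x : EReal) : ℝ≥0∞ := if x = ⊤ then ⊤ else ENNReal.ofReal x.toReal

/-- The integral of an `EReal`-valued function against a measure, with values in `EReal`:
the lower integral of the positive part minus the lower integral of the negative part. -/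
def eInt {d : ℕ} (μ : Measure (Euc d)) (u : Euc d → EReal) : EReal :=
  ((∫⁻ x, erealPos (u x) ∂μ : ℝ≥0∞) : EReal) -
    ((∫⁻ x, erealPos (-(u x)) ∂μ : ℝ≥0∞) : EReal)

/-- The (closed) support of a measure: points all of whose open neighbourhoods
have strictly positive measure. -/
def msupp {d : ℕ} (μ : Measure (Euc d)) : Set (Euc d) :=
  {x | ∀ U : Set (Euc d), IsOpen U → x ∈ U → 0 < μ U}

/-- A finite positive Borel measure whose support is a compact subset of `O`. -/
def MeasCompIn {d : ℕ} (μ : Measure (Euc d)) (O : Set (Euc d)) : Prop :=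
  IsCompact (msupp μ) ∧ msupp μ ⊆ O ∧ μ (msupp μ)ᶜ = 0 ∧ μ Set.univ < ⊤

/-- The *inward filling* of `S` with respect to `O`: the union of `S` with all connected
components of `O \ S` that are relatively compact in `O`. -/
def infill {X : Type*} [TopologicalSpace X] (O S : Set X) : Set X :=
  S ∪ {y | ∃ x ∈ O \ S, y ∈ connectedComponentIn (O \ S) x ∧
      IsCompact (closure (connectedComponentIn (O \ S) x)) ∧
      closure (connectedComponentIn (O \ S) x) ⊆ O}

open scoped Classical in
/-- The kernel `K_{d-2}(y,x)`: equal to `|y-x|` if `d = 1`, to `ln |y-x|` if `d = 2`,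
and to `-|y-x|^{-(d-2)}` if `d ≥ 3`; at `y = x` it equals `0` if `d = 1` and `-∞` if `d ≥ 2`. -/
def Kker (d : ℕ) (y x : Euc d) : EReal :=
  if d = 1 then ((dist y x : ℝ) : EReal)
  else if y = x then ⊥
  else if d = 2 then ((Real.log (dist y x) : ℝ) : EReal)
  else ((-(dist y x ^ (-((d : ℝ) - 2))) : ℝ) : EReal)

/-- The torsion function of the unit ball up to normalisation. -/
def ballBump {d : ℕ} (z : Euc d) : ℝ := max 0 (1 - ‖z‖ ^ 2) / 2

lemma ballBump_nonneg {d : ℕ} (z : Euc d) : 0 ≤ ballBump z := by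
  unfold ballBump; positivity

lemma ballBump_of_one_le {d : ℕ} {z : Euc d} (hz : 1 ≤ ‖z‖) : ballBump z = 0 := by
  unfold ballBump
  rw [max_eq_left (by nlinarith)]; simp

lemma ballBump_lipschitz {d : ℕ} : LipschitzWith 1 (ballBump (d := d)) := by
  have key : ∀ z : Euc d, ballBump z = (1 - (min ‖z‖ 1) ^ 2) / 2 := by
    intro z
    unfold ballBump
    rcases le_total ‖z‖ 1 with h | h
    · rw [min_eq_left h, max_eq_right (by nlinarith [norm_nonneg z])]
    · rw [min_eq_right h, max_eq_left (by nlinarith [norm_nonneg z])]; norm_num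
  refine LipschitzWith.of_dist_le_mul fun a b => ?_
  rw [Real.dist_eq, key, key, NNReal.coe_one, one_mul]
  have h1 : |min ‖b‖ 1 - min ‖a‖ 1| ≤ dist a b := by
    refine (abs_min_sub_min_le_max _ _ _ _).trans ?_
    rw [sub_self, abs_zero, max_eq_left (abs_nonneg _), dist_comm, dist_eq_norm]
    exact abs_norm_sub_norm_le _ _
  refine le_trans ?_ h1
  have h2 : (1 - min ‖a‖ 1 ^ 2) / 2 - (1 - min ‖b‖ 1 ^ 2) / 2
      = (min ‖b‖ 1 - min ‖a‖ 1) * ((min ‖b‖ 1 + min ‖a‖ 1) / 2) := by ring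
  rw [h2, abs_mul]
  refine mul_le_of_le_one_right (abs_nonneg _) ?_
  rw [abs_of_nonneg (by positivity)]
  linarith [min_le_right ‖a‖ 1, min_le_right ‖b‖ 1]

lemma lineDeriv_ballBump_of_lt {d : ℕ} {z : Euc d} (hz : ‖z‖ < 1) (v : Euc d) :
    lineDeriv ℝ ballBump z v = -inner ℝ z v := by
  have h1 : HasFDerivAt (fun y : Euc d => (1 - ‖y‖ ^ 2) / 2) (-innerSL ℝ z) z := by
    have := ((hasStrictFDerivAt_norm_sq z).hasFDerivAt.const_sub 1).const_mul (1 / 2 : ℝ)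
    refine (this.congr_fderiv ?_).congr_of_eventuallyEq (Eventually.of_forall fun y => ?_)
    · ext w; simp
    · simp only; ring
  have h2 : ballBump =ᶠ[𝓝 z] (fun y : Euc d => (1 - ‖y‖ ^ 2) / 2) := by
    filter_upwards [(isOpen_lt continuous_norm continuous_const).mem_nhds hz] with y hy
    have hy : ‖y‖ < 1 := hy
    unfold ballBump
    rw [max_eq_right (by nlinarith [norm_nonneg y])]
  have := (h1.congr_of_eventuallyEq h2).hasLineDerivAt v
  rw [this.lineDeriv]; simp

lemma lineDeriv_ballBump_of_gt {d : ℕ} {z : Euc d} (hz : 1 < ‖z‖) (v : Euc d) :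
    lineDeriv ℝ ballBump z v = 0 := by
  have h2 : ballBump =ᶠ[𝓝 z] (fun _ : Euc d => 0) := by
    filter_upwards [(isOpen_lt continuous_const continuous_norm).mem_nhds hz] with y hy
    exact ballBump_of_one_le hy.le
  rw [h2.lineDeriv_eq]; simp [lineDeriv]

lemma integral_ball_inner_mul {d : ℕ} (hd : 0 < d) {f : Euc d → ℝ} (hf : ContDiff ℝ 1 f)
    (v : Euc d) :
    ∫ z in ball (0 : Euc d) 1, inner ℝ z v * f z = ∫ z, fderiv ℝ f z v * ballBump z := by
  have : Nonempty (Fin d) := ⟨⟨0, hd⟩⟩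
  let χ : ContDiffBump (0 : Euc d) := ⟨1, 2, one_pos, one_lt_two⟩
  have hg : ContDiff ℝ 1 (fun z => χ z * f z) := χ.contDiff.mul hf
  have hc : HasCompactSupport (fun z => χ z * f z) := χ.hasCompactSupport.mul_right
  obtain ⟨D, hD⟩ := hg.lipschitzWith_of_hasCompactSupport hc (by simp)
  have key := ballBump_lipschitz (d := d).integral_lineDeriv_mul_eq (μ := volume) hD hc v
  have hae : ∀ᵐ z : Euc d ∂volume, ‖z‖ ≠ 1 := by
    rw [ae_iff]
    have : {a : Euc d | ¬‖a‖ ≠ 1} = sphere 0 1 := by ext; simp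
    rw [this]; exact Measure.addHaar_sphere _ _ _
  have hχ : ∀ z : Euc d, ‖z‖ < 1 → (fun z => χ z * f z) =ᶠ[𝓝 z] f := by
    intro z hz
    filter_upwards [(isOpen_lt continuous_norm continuous_const).mem_nhds hz] with y hy
    have : χ y = 1 := χ.one_of_mem_closedBall (by simpa using le_of_lt hy)
    rw [this, one_mul]
  have h1 : ∫ z in ball (0 : Euc d) 1, inner ℝ z v * f z
      = -∫ z, lineDeriv ℝ ballBump z v * (χ z * f z) := by
    rw [← integral_neg, ← integral_indicator measurableSet_ball]
    refine integral_congr_ae ?_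
    filter_upwards [hae] with z hz
    rcases lt_or_gt_of_ne hz with h | h
    · have e : χ z * f z = f z := (hχ z h).eq_of_nhds
      rw [indicator_of_mem (by simpa using h), lineDeriv_ballBump_of_lt h, e]
      ring
    · rw [indicator_of_notMem (by simpa using h.le), lineDeriv_ballBump_of_gt h]; simp
  rw [h1, key, ← integral_neg]
  refine integral_congr_ae ?_
  filter_upwards [hae] with z hz
  rcases lt_or_gt_of_ne hz with h | h
  · rw [(hχ z h).lineDeriv_eq, ((hf.differentiable (by simp)) z).lineDeriv_eq_fderiv]; simp
  · rw [ballBump_of_one_le h.le]; simp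

/-- Solid sub-mean value inequality for a function with nonnegative Laplacian on a ball. The
functions `g i` are the first partial derivatives. -/
theorem le_average_of_laplacian_nonneg {d : ℕ} (hd : 0 < d) {h : Euc d → ℝ}
    {g : Fin d → Euc d → ℝ} {x : Euc d} {r : ℝ} (hr : 0 < r) (hh : ContDiff ℝ 1 h)
    (hg : ∀ i, ContDiff ℝ 1 (g i))
    (hhg : ∀ i y, fderiv ℝ h y (EuclideanSpace.single i 1) = g i y)
    (hΔ : ∀ y ∈ ball x r, 0 ≤ ∑ i, fderiv ℝ (g i) y (EuclideanSpace.single i 1)) :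
    h x ≤ ⨍ y in closedBall x r, h y := by
  have : Nonempty (Fin d) := ⟨⟨0, hd⟩⟩
  set M : ℝ → ℝ := fun t => ∫ z in ball (0 : Euc d) 1, h (x + t • z) with hM
  set M' : ℝ → ℝ := fun t => ∫ z in ball (0 : Euc d) 1, fderiv ℝ h (x + t • z) z with hM'
  have hfin : IsFiniteMeasure ((volume : Measure (Euc d)).restrict (ball 0 1)) :=
    ⟨by simpa using measure_ball_lt_top⟩
  have hcont : Continuous fun p : ℝ × Euc d => fderiv ℝ h (x + p.1 • p.2) p.2 :=
    ((hh.continuous_fderiv (by simp)).comp (by fun_prop)).clm_apply continuous_snd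
  have hint : ∀ F : Euc d → ℝ, Continuous F → IntegrableOn F (ball (0 : Euc d) 1) := fun F hF =>
    (hF.continuousOn.integrableOn_compact (isCompact_closedBall 0 1)).mono_set ball_subset_closedBall
  have hderiv : ∀ t, HasDerivAt M (M' t) t := by
    intro t
    obtain ⟨C, hC⟩ := ((isCompact_closedBall t 1).prod
      (isCompact_closedBall (0 : Euc d) 1)).exists_bound_of_continuousOn hcont.continuousOn
    refine (hasDerivAt_integral_of_dominated_loc_of_deriv_le (bound := fun _ => C)
      (F' := fun t z => fderiv ℝ h (x + t • z) z)
      (closedBall_mem_nhds t one_pos) ?_ ?_ ?_ ?_ ?_ ?_).2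
    · exact Eventually.of_forall fun s => (hint _ (hh.continuous.comp (by fun_prop))).aestronglyMeasurable
    · exact hint _ (hh.continuous.comp (by fun_prop))
    · exact (hint _ (hcont.comp (by fun_prop : Continuous fun z : Euc d => (t, z)))).aestronglyMeasurable
    · filter_upwards [ae_restrict_mem measurableSet_ball] with z hz s hs
      exact hC (s, z) ⟨hs, ball_subset_closedBall hz⟩
    · exact integrable_const _
    · refine Eventually.of_forall fun z s _ => ?_
      have h1 : HasDerivAt (fun s : ℝ => x + s • z) z s := by
        simpa using ((hasDerivAt_id s).smul_const z).const_add x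
      exact ((hh.differentiable (by simp)) (x + s • z)).hasFDerivAt.comp_hasDerivAt s h1
  have hM'_nonneg : ∀ t ∈ interior (Icc 0 r), 0 ≤ deriv M t := by
    intro t ht
    rw [interior_Icc] at ht
    rw [(hderiv t).deriv]
    have hgt : ∀ i, ContDiff ℝ 1 fun z : Euc d => g i (x + t • z) := fun i =>
      (hg i).comp (by fun_prop)
    have hfd : ∀ i z v, fderiv ℝ (fun z : Euc d => g i (x + t • z)) z v
        = t * fderiv ℝ (g i) (x + t • z) v := by
      intro i z v
      have h1 : HasFDerivAt (fun z : Euc d => x + t • z) (t • ContinuousLinearMap.id ℝ (Euc d)) z :=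
        ((hasFDerivAt_id z).const_smul t).const_add x
      have h2 := (((hg i).differentiable (by simp)) (x + t • z)).hasFDerivAt.comp z h1
      have h3 := h2.fderiv
      simp only [Function.comp_def] at h3
      rw [h3]; simp
    have e1 : M' t = ∑ i, ∫ z in ball (0 : Euc d) 1,
        inner ℝ z (EuclideanSpace.single i (1 : ℝ)) * g i (x + t • z) := by
      rw [hM']; simp only
      rw [← integral_finsetSum]
      · refine integral_congr_ae (Eventually.of_forall fun z => ?_)
        simp only
        have hz : z = ∑ i, z i • EuclideanSpace.single i (1 : ℝ) := by
          simpa using ((EuclideanSpace.basisFun (Fin d) ℝ).sum_repr z).symm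
        conv_lhs => rw [hz]
        rw [map_sum]
        refine Finset.sum_congr rfl fun i _ => ?_
        rw [← hz, map_smul, hhg, EuclideanSpace.inner_single_right]; simp
      · intro i _
        exact hint _ (by have := (hgt i).continuous; fun_prop)
    rw [e1]
    simp only [fun i => integral_ball_inner_mul hd (hgt i) (EuclideanSpace.single i (1 : ℝ)), hfd]
    rw [← integral_finsetSum]
    · refine integral_nonneg fun z => ?_
      simp only [Pi.zero_apply]
      rw [← Finset.sum_mul, ← Finset.mul_sum]
      rcases lt_or_ge ‖z‖ 1 with hz | hz
      · refine mul_nonneg (mul_nonneg ht.1.le (hΔ _ ?_)) (ballBump_nonneg z)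
        rw [mem_ball, dist_eq_norm, add_sub_cancel_left, norm_smul, Real.norm_of_nonneg ht.1.le]
        nlinarith [norm_nonneg z, ht.1, ht.2]
      · rw [ballBump_of_one_le hz, mul_zero]
    · intro i _
      refine Continuous.integrable_of_hasCompactSupport ?_ ?_
      · have h1 := (hg i).continuous_fderiv (by simp)
        have h2 := ballBump_lipschitz (d := d).continuous
        have h3 : Continuous fun z : Euc d => fderiv ℝ (g i) (x + t • z) (EuclideanSpace.single i 1) :=
          (h1.comp (by fun_prop)).clm_apply continuous_const
        fun_prop
      · refine HasCompactSupport.intro (isCompact_closedBall (0 : Euc d) 1) fun z hz => ?_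
        rw [ballBump_of_one_le, mul_zero]
        simpa using (le_of_lt (by simpa using hz))
  have hmono : MonotoneOn M (Icc 0 r) :=
    monotoneOn_of_deriv_nonneg (convex_Icc 0 r)
      (fun t _ => (hderiv t).continuousAt.continuousWithinAt)
      (fun t _ => (hderiv t).differentiableAt.differentiableWithinAt) hM'_nonneg
  have h0r := hmono (left_mem_Icc.2 hr.le) (right_mem_Icc.2 hr.le) hr.le
  have hM0 : M 0 = volume.real (ball (0 : Euc d) 1) * h x := by
    simp [hM, measureReal_restrict_apply]
  have hMr : M r = (r ^ d)⁻¹ * ∫ y in ball x r, h y := by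
    rw [hM]; simp only
    rw [← integral_indicator measurableSet_ball, ← integral_indicator measurableSet_ball]
    have e := Measure.integral_comp_smul (volume : Measure (Euc d))
      (fun y => (ball x r).indicator h (x + y)) r
    rw [integral_add_left_eq_self (fun y => (ball x r).indicator h y) x] at e
    rw [finrank_euclideanSpace_fin, abs_of_pos (by positivity), smul_eq_mul] at e
    rw [← e]
    refine integral_congr_ae (Eventually.of_forall fun z => ?_)
    simp only [indicator, mem_ball, dist_eq_norm, add_sub_cancel_left, norm_smul,
      Real.norm_of_nonneg hr.le]
    have : r * ‖z‖ < r ↔ ‖z‖ < 1 := by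
      constructor <;> intro h' <;> nlinarith
    simp [this]
  have hvol : volume.real (ball x r) = r ^ d * volume.real (ball (0 : Euc d) 1) := by
    have := Measure.addHaar_ball (volume : Measure (Euc d)) x hr.le
    rw [measureReal_def, this, ENNReal.toReal_mul, ENNReal.toReal_ofReal (by positivity),
      finrank_euclideanSpace_fin, measureReal_def]
  have hpos : 0 < volume.real (ball (0 : Euc d) 1) :=
    ENNReal.toReal_pos (measure_ball_pos _ _ one_pos).ne' measure_ball_lt_top.ne
  have hae : (closedBall x r : Set (Euc d)) =ᵐ[volume] ball x r := by
    refine (ae_eq_set.2 ⟨?_, ?_⟩)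
    · rw [closedBall_sdiff_ball]; exact Measure.addHaar_sphere _ _ _
    · rw [sdiff_eq_empty.2 ball_subset_closedBall]; simp
  rw [setAverage_congr hae, setAverage_eq, hvol, smul_eq_mul]
  rw [hM0, hMr] at h0r
  have hrd : 0 < r ^ d := by positivity
  rw [mul_inv]
  calc h x = (volume.real (ball (0 : Euc d) 1))⁻¹ * (volume.real (ball (0 : Euc d) 1) * h x) := by
        field_simp
    _ ≤ (volume.real (ball (0 : Euc d) 1))⁻¹ * ((r ^ d)⁻¹ * ∫ y in ball x r, h y) := by gcongr
    _ = _ := by ring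

lemma le_average_radial {d : ℕ} (hd : 0 < d) {F : ℝ → ℝ} (hF : ContDiff ℝ 2 F) (c x : Euc d)
    {r : ℝ} (hr : 0 < r)
    (h : ∀ y ∈ ball x r, 0 ≤ 2 * d * deriv F (‖y - c‖ ^ 2)
      + 4 * ‖y - c‖ ^ 2 * deriv (deriv F) (‖y - c‖ ^ 2)) :
    F (‖x - c‖ ^ 2) ≤ ⨍ y in closedBall x r, F (‖y - c‖ ^ 2) := by
  have hF' : ContDiff ℝ 1 (deriv F) := by
    have : ContDiff ℝ (1 + 1) F := by simpa [one_add_one_eq_two] using hF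
    exact (contDiff_succ_iff_deriv.1 this).2.2
  have hsq : ContDiff ℝ 1 fun y : Euc d => ‖y - c‖ ^ 2 := (contDiff_id.sub contDiff_const).norm_sq ℝ
  have hsqd : ∀ y : Euc d, HasFDerivAt (fun y : Euc d => ‖y - c‖ ^ 2)
      ((2 : ℝ) • innerSL ℝ (y - c)) y := by
    intro y
    have := (hasStrictFDerivAt_norm_sq (y - c)).hasFDerivAt.comp y ((hasFDerivAt_id y).sub_const c)
    refine this.congr_fderiv ?_
    ext; simp
  have hco : ∀ i : Fin d, ContDiff ℝ 1 fun y : Euc d => y i := fun i =>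
    (EuclideanSpace.proj (𝕜 := ℝ) i).contDiff
  have hcod : ∀ (i : Fin d) (y : Euc d), HasFDerivAt (fun y : Euc d => y i)
      (EuclideanSpace.proj (𝕜 := ℝ) i) y := fun i y =>
    (EuclideanSpace.proj (𝕜 := ℝ) i).hasFDerivAt
  refine le_average_of_laplacian_nonneg hd (h := fun y => F (‖y - c‖ ^ 2))
    (g := fun i y => 2 * (y i - c i) * deriv F (‖y - c‖ ^ 2)) hr
    ((hF.of_le (by norm_num)).comp hsq) ?_ ?_ ?_
  · intro i
    exact (contDiff_const.mul ((hco i).sub contDiff_const)).mul (hF'.comp hsq)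
  · intro i y
    have h1 := ((hF.differentiable (by simp)) (‖y - c‖ ^ 2)).hasDerivAt.comp_hasFDerivAt y (hsqd y)
    have h2 := h1.fderiv
    simp only [Function.comp_def] at h2
    rw [h2]
    simp [EuclideanSpace.inner_single_right]; ring
  · intro y hy
    have e : ∀ i : Fin d, fderiv ℝ (fun y : Euc d => 2 * (y i - c i) * deriv F (‖y - c‖ ^ 2)) y
        (EuclideanSpace.single i 1) = 2 * deriv F (‖y - c‖ ^ 2)
          + 4 * (y i - c i) ^ 2 * deriv (deriv F) (‖y - c‖ ^ 2) := by
      intro i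
      have h1 := ((hF'.differentiable (by simp)) (‖y - c‖ ^ 2)).hasDerivAt.comp_hasFDerivAt y (hsqd y)
      have h2 := ((((hcod i y).sub_const (c i)).const_mul 2).mul h1).fderiv
      simp only [Function.comp_def] at h2
      erw [h2]
      simp [EuclideanSpace.inner_single_right]; ring
    simp only [e]
    rw [Finset.sum_add_distrib, ← Finset.sum_mul, ← Finset.sum_mul, ← Finset.mul_sum]
    have hn : ∑ i, (y i - c i) ^ 2 = ‖y - c‖ ^ 2 := by
      rw [EuclideanSpace.norm_sq_eq]; simp
    rw [hn]
    simpa [mul_comm, mul_left_comm, mul_assoc] using h y hy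

/-- The radial profile of the kernel. -/
def kap (d : ℕ) (s : ℝ) : ℝ :=
  if d = 1 then s else if d = 2 then Real.log s else -(s ^ (-((d : ℝ) - 2)))

lemma Kker_of_ne {d : ℕ} {x y : Euc d} (h : y ≠ x) :
    Kker d y x = ((kap d (dist y x) : ℝ) : EReal) := by
  unfold Kker kap
  split_ifs <;> simp_all

lemma Kker_self {d : ℕ} (hd : d ≠ 1) (x : Euc d) : Kker d x x = ⊥ := by
  unfold Kker; simp [hd]

lemma Kker_one (y x : Euc 1) : Kker 1 y x = ((kap 1 (dist y x) : ℝ) : EReal) := by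
  unfold Kker kap; simp

lemma kap_contDiffAt (d : ℕ) {n : WithTop ℕ∞} {s : ℝ} (hs : 0 < s) : ContDiffAt ℝ n (kap d) s := by
  unfold kap
  split_ifs
  · exact contDiffAt_id
  · exact Real.contDiffAt_log.2 hs.ne'
  · exact (Real.contDiffAt_rpow_const_of_ne hs.ne').neg

lemma kap_continuousOn (d : ℕ) : ContinuousOn (kap d) (Ioi 0) := fun _ hs =>
  ((kap_contDiffAt d (n := 0) hs).continuousAt).continuousWithinAt

lemma kap_strictMonoOn {d : ℕ} (hd : 0 < d) : StrictMonoOn (kap d) (Ioi 0) := by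
  intro a ha b hb hab
  unfold kap
  split_ifs with h1 h2
  · exact hab
  · exact Real.log_lt_log ha hab
  · refine neg_lt_neg (Real.rpow_lt_rpow_of_neg ha hab ?_)
    have : (3 : ℝ) ≤ d := by exact_mod_cast (by omega : 3 ≤ d)
    linarith

/-- The normalising constant in the derivative of the kernel. -/
def kapConst (d : ℕ) : ℝ := if d = 1 then 1 / 2 else if d = 2 then 1 / 2 else ((d : ℝ) - 2) / 2

lemma kap_sqrt_hasDerivAt {d : ℕ} (hd : 0 < d) {s : ℝ} (hs : 0 < s) :
    HasDerivAt (fun s => kap d (√s)) (kapConst d * s ^ (-(d : ℝ) / 2)) s := by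
  unfold kapConst kap
  split_ifs with h1 h2
  · subst h1
    refine (Real.hasDerivAt_sqrt hs.ne').congr_deriv ?_
    rw [Real.sqrt_eq_rpow, show (-((1 : ℕ) : ℝ) / 2) = -(1 / 2) by norm_num, Real.rpow_neg hs.le]
    field_simp
  · subst h2
    have : (fun s : ℝ => Real.log (√s)) =ᶠ[𝓝 s] fun s => Real.log s / 2 := by
      filter_upwards [lt_mem_nhds hs] with t ht
      rw [Real.log_sqrt ht.le]
    refine (((Real.hasDerivAt_log hs.ne').div_const 2).congr_of_eventuallyEq this).congr_deriv ?_
    rw [show (-((2 : ℕ) : ℝ) / 2) = -1 by norm_num, Real.rpow_neg_one]; ring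
  · have : (fun s : ℝ => -(√s ^ (-((d : ℝ) - 2)))) =ᶠ[𝓝 s] fun s => -(s ^ (-((d : ℝ) - 2) / 2)) := by
      filter_upwards [lt_mem_nhds hs] with t ht
      rw [Real.sqrt_eq_rpow, ← Real.rpow_mul ht.le]; ring_nf
    refine (((Real.hasDerivAt_rpow_const (Or.inl hs.ne')).neg).congr_of_eventuallyEq
      this).congr_deriv ?_
    rw [show -((d : ℝ) - 2) / 2 - 1 = -(d : ℝ) / 2 by ring]; ring

/-- The kernel satisfies the solid mean value property away from its pole. -/
theorem kap_average {d : ℕ} (hd : 0 < d) (c x : Euc d) {r : ℝ} (hr : 0 < r) (hrx : r < dist x c) :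
    kap d (dist x c) = ⨍ y in closedBall x r, kap d (dist y c) := by
  set a : ℝ := (dist x c - r) ^ 2 / 2 with ha
  have ha0 : 0 < a := by have : 0 < dist x c - r := by linarith
                         positivity
  set F : ℝ → ℝ := fun s => Real.smoothTransition ((s - a) / a) * kap d (√s) with hF
  have hFe : ∀ s, 2 * a ≤ s → F s = kap d (√s) := by
    intro s hs
    simp only [hF]
    rw [Real.smoothTransition.one_of_one_le, one_mul]
    rw [le_div_iff₀ ha0]; linarith
  have hFs : ContDiff ℝ 2 F := by
    rw [contDiff_iff_contDiffAt]
    intro s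
    rcases lt_or_ge s a with h | h
    · have : F =ᶠ[𝓝 s] fun _ => 0 := by
        filter_upwards [gt_mem_nhds h] with t ht
        simp only [hF]
        rw [Real.smoothTransition.zero_of_nonpos, zero_mul]
        exact div_nonpos_of_nonpos_of_nonneg (by linarith) ha0.le
      exact contDiffAt_const.congr_of_eventuallyEq this
    · have hs : 0 < s := ha0.trans_le h
      refine ContDiffAt.mul ?_ ((kap_contDiffAt d (Real.sqrt_pos.2 hs)).comp s
        (Real.contDiffAt_sqrt hs.ne'))
      exact Real.smoothTransition.contDiff.contDiffAt.comp s (by fun_prop)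
  have hs : ∀ y ∈ closedBall x r, 2 * a ≤ ‖y - c‖ ^ 2 := by
    intro y hy
    rw [ha, ← dist_eq_norm]
    have := dist_triangle x y c
    rw [dist_comm x y] at this
    have hy' : dist y x ≤ r := hy
    have : dist x c - r ≤ dist y c := by linarith
    nlinarith
  have hs' : ∀ y ∈ ball x r, 2 * a < ‖y - c‖ ^ 2 := by
    intro y hy
    rw [ha, ← dist_eq_norm]
    have := dist_triangle x y c
    rw [dist_comm x y] at this
    have hy' : dist y x < r := hy
    have : dist x c - r < dist y c := by linarith
    nlinarith
  have hd1 : ∀ s, 2 * a < s → deriv F s = kapConst d * s ^ (-(d : ℝ) / 2) := by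
    intro s h
    refine ((kap_sqrt_hasDerivAt hd (by linarith)).congr_of_eventuallyEq ?_).deriv
    filter_upwards [lt_mem_nhds h] with t ht using hFe t ht.le
  have hd2 : ∀ s, 2 * a < s →
      2 * d * deriv F s + 4 * s * deriv (deriv F) s = 0 := by
    intro s h
    have h0 : 0 < s := by linarith
    have e : deriv (deriv F) s = kapConst d * ((-(d : ℝ) / 2) * s ^ (-(d : ℝ) / 2 - 1)) := by
      refine (((Real.hasDerivAt_rpow_const (Or.inl h0.ne')).const_mul _).congr_of_eventuallyEq
        ?_).deriv
      filter_upwards [lt_mem_nhds h] with t ht using hd1 t ht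
    rw [e, hd1 s h, Real.rpow_sub_one h0.ne']
    field_simp
    ring
  have hval : ∀ y ∈ closedBall x r, F (‖y - c‖ ^ 2) = kap d (dist y c) := by
    intro y hy
    rw [hFe _ (hs y hy), Real.sqrt_sq (norm_nonneg _), dist_eq_norm]
  have havg : ⨍ y in closedBall x r, F (‖y - c‖ ^ 2) = ⨍ y in closedBall x r, kap d (dist y c) :=
    setAverage_congr_fun measurableSet_closedBall (Eventually.of_forall hval)
  have h1 := le_average_radial hd hFs c x hr fun y hy => (hd2 _ (hs' y hy)).ge
  have h2 := le_average_radial hd hFs.neg c x hr fun y hy => by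
    have e1 : deriv (fun s => -F s) = fun s => -deriv F s := by ext; exact deriv.fun_neg
    have e2 : deriv (fun s => -deriv F s) = fun s => -deriv (deriv F) s := by
      ext; exact deriv.fun_neg
    have := hd2 _ (hs' y hy)
    simp only [e1, e2]
    linarith
  have h3 : ⨍ y in closedBall x r, -F (‖y - c‖ ^ 2) = -⨍ y in closedBall x r, F (‖y - c‖ ^ 2) := by
    simp only [average_eq, integral_neg, smul_neg]
  rw [h3] at h2
  rw [← hval x (mem_closedBall_self hr.le), ← havg]
  linarith

lemma norm_sq_le_average {d : ℕ} (hd : 0 < d) (x : Euc d) {r : ℝ} (hr : 0 < r) :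
    ‖x‖ ^ 2 ≤ ⨍ y in closedBall x r, ‖y‖ ^ 2 := by
  have := le_average_radial hd (F := id) contDiff_id 0 x hr fun y _ => by
    have : deriv (fun _ : ℝ => (1 : ℝ)) = fun _ => 0 := by ext; simp
    simp only [deriv_id', this]
    positivity
  simpa using this

lemma integrableOn_closedBall {d : ℕ} {q : Euc d → ℝ} {y : Euc d} {r : ℝ}
    (hq : ContinuousOn q (closedBall y r)) : IntegrableOn q (closedBall y r) :=
  hq.integrableOn_compact (isCompact_closedBall y r)

lemma volume_real_closedBall_pos {d : ℕ} (y : Euc d) {r : ℝ} (hr : 0 < r) :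
    0 < volume.real (closedBall y r) :=
  ENNReal.toReal_pos (measure_closedBall_pos _ _ hr).ne' measure_closedBall_lt_top.ne

lemma average_affine {d : ℕ} {q : Euc d → ℝ} {y : Euc d} {r : ℝ} (hr : 0 < r)
    (hq : ContinuousOn q (closedBall y r)) (C M : ℝ) :
    ⨍ z in closedBall y r, (C * q z - M) = C * (⨍ z in closedBall y r, q z) - M := by
  have hp := volume_real_closedBall_pos y hr
  rw [setAverage_eq, setAverage_eq, integral_sub ((integrableOn_closedBall hq).const_mul C)
    (integrableOn_const measure_closedBall_lt_top.ne), integral_const_mul, setIntegral_const]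
  simp only [smul_eq_mul]
  field_simp

lemma average_sub {d : ℕ} {p q : Euc d → ℝ} {y : Euc d} {r : ℝ}
    (hp : ContinuousOn p (closedBall y r)) (hq : ContinuousOn q (closedBall y r)) :
    ⨍ z in closedBall y r, (p z - q z)
      = (⨍ z in closedBall y r, p z) - ⨍ z in closedBall y r, q z := by
  rw [setAverage_eq, setAverage_eq, setAverage_eq,
    integral_sub (integrableOn_closedBall hp) (integrableOn_closedBall hq), smul_sub]

lemma eq_of_le_average {d : ℕ} {q : Euc d → ℝ} {y : Euc d} {r m : ℝ} (hr : 0 < r)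
    (hq : ContinuousOn q (closedBall y r)) (hle : ∀ z ∈ closedBall y r, q z ≤ m)
    (hm : m ≤ ⨍ z in closedBall y r, q z) : ∀ z ∈ ball y r, q z = m := by
  have hp := volume_real_closedBall_pos y hr
  have h0 : ⨍ z in closedBall y r, (-1 * q z - -m) ≤ 0 := by
    rw [average_affine hr hq]; linarith
  have hqi : ContinuousOn (fun z => -1 * q z - -m) (closedBall y r) := by fun_prop
  rw [setAverage_eq, smul_eq_mul] at h0
  have hnn : 0 ≤ᵐ[volume.restrict (closedBall y r)] fun z => -1 * q z - -m := by
    filter_upwards [ae_restrict_mem measurableSet_closedBall] with z hz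
    have := hle z hz
    simp only [Pi.zero_apply]; linarith
  have h1 : ∫ z in closedBall y r, (-1 * q z - -m) = 0 := by
    refine le_antisymm ?_ (integral_nonneg_of_ae hnn)
    by_contra! hcon
    have := mul_pos (inv_pos.2 hp) hcon
    linarith
  have h2 := (setIntegral_eq_zero_iff_of_nonneg_ae hnn (integrableOn_closedBall hqi)).1 h1
  have h3 := Measure.eqOn_open_of_ae_eq (ae_restrict_of_ae_restrict_of_subset
    ball_subset_closedBall h2) isOpen_ball (hqi.mono ball_subset_closedBall) continuousOn_const
  intro z hz
  have := h3 hz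
  simp only [Pi.zero_apply] at this
  linarith

/-- The solid sub-mean value inequality at a point, for all small radii. -/
def SubMean {d : ℕ} (k : Euc d → ℝ) (y : Euc d) : Prop :=
  ∀ᶠ r in 𝓝[>] (0 : ℝ), ContinuousOn k (closedBall y r) ∧ k y ≤ ⨍ z in closedBall y r, k z

lemma exists_mem_ball_dist_lt {d : ℕ} (hd : 0 < d) (x y : Euc d) {r : ℝ} (hr : 0 < r) :
    ∃ z ∈ ball y r, dist y x < dist z x := by
  have : Nonempty (Fin d) := ⟨⟨0, hd⟩⟩
  by_cases h : y = x
  · obtain ⟨e, he⟩ := exists_norm_eq (Euc d) (by positivity : 0 ≤ r / 2)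
    refine ⟨y + e, ?_, ?_⟩
    · rw [mem_ball, dist_eq_norm, add_sub_cancel_left, he]; linarith
    · subst h
      rw [dist_self, dist_eq_norm, add_sub_cancel_left, he]; positivity
  · have hn : 0 < ‖y - x‖ := norm_pos_iff.2 (sub_ne_zero.2 h)
    refine ⟨y + (r / 2 / ‖y - x‖) • (y - x), ?_, ?_⟩
    · rw [mem_ball, dist_eq_norm, add_sub_cancel_left, norm_smul, Real.norm_of_nonneg (by positivity)]
      field_simp; linarith
    · have e : y + (r / 2 / ‖y - x‖) • (y - x) - x = (1 + r / 2 / ‖y - x‖) • (y - x) := by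
        rw [add_smul, one_smul]; abel
      rw [dist_eq_norm, dist_eq_norm, e, norm_smul, Real.norm_of_nonneg (by positivity)]
      have : 0 < r / 2 / ‖y - x‖ := by positivity
      nlinarith

/-- An upper semicontinuous function touched from below at each point by a function with the
local sub-mean value property is subharmonic. -/
theorem sbhOn_of_touching {d : ℕ} (hd : 0 < d) {O : Set (Euc d)} {u : Euc d → EReal}
    (husc : UpperSemicontinuousOn u O) (htop : ∀ x ∈ O, u x < ⊤)
    (ht : ∀ y ∈ O, u y = ⊥ ∨ ∃ k : Euc d → ℝ, u y = (k y : EReal) ∧ SubMean k y ∧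
      ∀ᶠ z in 𝓝 y, (k z : EReal) ≤ u z) : SbhOn u O := by
  refine ⟨husc, htop, fun x r hr hball h hh hH hs => ?_⟩
  by_contra! hcon
  obtain ⟨y0, hy0, hlt⟩ := hcon
  set w : Euc d → EReal := fun z => u z + ((-h z : ℝ) : EReal) with hw
  have hwusc : UpperSemicontinuousOn w (closedBall x r) := by
    refine (husc.mono hball).add' ?_ fun z hz => ?_
    · refine ContinuousOn.upperSemicontinuousOn ?_
      exact continuous_coe_real_ereal.comp_continuousOn hh.neg
    · exact EReal.continuousAt_add (Or.inr (by simp)) (Or.inr (by simp))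
  obtain ⟨y1, hy1, hmax⟩ := hwusc.exists_isMaxOn ⟨y0, hy0⟩ (isCompact_closedBall x r)
  have hpos : ∀ z, (h z : EReal) < u z ↔ 0 < w z := by
    intro z
    simp only [hw, EReal.coe_neg, ← sub_eq_add_neg]
    rw [EReal.sub_pos]
  have hw1 : 0 < w y1 := ((hpos y0).1 hlt).trans_le (hmax hy0)
  set K : Set (Euc d) := closedBall x r ∩ w ⁻¹' Ici (w y1) with hK
  have hKc : IsCompact K := by
    obtain ⟨v, hv, hv'⟩ := upperSemicontinuousOn_iff_preimage_Ici.1 hwusc (w y1)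
    have : K = closedBall x r ∩ v := hv'
    rw [this]
    exact (isCompact_closedBall x r).inter_right hv
  obtain ⟨y2, hy2, hfar⟩ := hKc.exists_isMaxOn ⟨y1, hy1, le_refl (w y1)⟩
    (f := fun z => dist z x) (by fun_prop)
  have hw2 : w y2 = w y1 := le_antisymm (hmax hy2.1) hy2.2
  have hy2b : y2 ∈ ball x r := by
    rcases (mem_closedBall.1 hy2.1).lt_or_eq with h' | h'
    · exact h'
    · have := (hpos y2).2 (hw2 ▸ hw1)
      exact absurd (hs y2 h') (not_le.2 this)
  rcases ht y2 (hball hy2.1) with hbot | ⟨k, hk, hsub, hle⟩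
  · have : w y2 = ⊥ := by simp [hw, hbot]
    rw [hw2] at this
    rw [this] at hw1
    exact absurd hw1 (by simp)
  set m : ℝ := k y2 - h y2 with hm
  have hwm : w y2 = (m : EReal) := by
    simp only [hw, hk, hm, sub_eq_add_neg, EReal.coe_add]
  obtain ⟨ε, hε, hεb⟩ := Metric.eventually_nhds_iff_ball.1
    (hle.and (isOpen_ball.mem_nhds hy2b))
  have hsmall : ∀ᶠ s in 𝓝[>] (0 : ℝ), s < ε := eventually_nhdsWithin_of_eventually_nhds (gt_mem_nhds hε)
  obtain ⟨s, ⟨⟨hks, hkavg⟩, hsε⟩, hs0⟩ := ((hsub.and hsmall).and self_mem_nhdsWithin).exists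
  have hs0 : 0 < s := hs0
  have hsb : closedBall y2 s ⊆ ball x r := fun z hz =>
    (hεb z (lt_of_le_of_lt hz hsε)).2
  have hhs : ContinuousOn h (closedBall y2 s) := hh.mono (hsb.trans ball_subset_closedBall)
  have hle' : ∀ z ∈ closedBall y2 s, k z - h z ≤ m := by
    intro z hz
    have h1 := (hεb z (lt_of_le_of_lt hz hsε)).1
    have h2 : w z ≤ (m : EReal) := by
      rw [← hwm, hw2]; exact hmax (ball_subset_closedBall (hsb hz))
    have h3 : ((k z - h z : ℝ) : EReal) ≤ w z := by
      rw [sub_eq_add_neg, EReal.coe_add]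
      exact add_le_add_left h1 _
    exact_mod_cast h3.trans h2
  have heq := eq_of_le_average (q := fun z => k z - h z) hs0 (hks.sub hhs) hle' (by
    rw [average_sub hks hhs, ← hH.2 y2 s hs0 hsb]
    linarith)
  obtain ⟨z, hz, hzd⟩ := exists_mem_ball_dist_lt hd x y2 hs0
  have hzK : z ∈ K := by
    refine ⟨ball_subset_closedBall (hsb (ball_subset_closedBall hz)), ?_⟩
    have h1 := (hεb z (lt_trans hz hsε)).1
    have h3 : ((k z - h z : ℝ) : EReal) ≤ w z := by
      rw [sub_eq_add_neg, EReal.coe_add]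
      exact add_le_add_left h1 _
    rw [mem_preimage, mem_Ici, ← hw2, hwm, ← heq z hz]
    exact h3
  exact absurd (hfar hzK) (not_le.2 hzd)

lemma erealPos_coe (a : ℝ) : erealPos (a : EReal) = ENNReal.ofReal a := by
  simp [erealPos]

lemma eInt_congr_ae {d : ℕ} {μ : Measure (Euc d)} {u v : Euc d → EReal} (h : u =ᵐ[μ] v) :
    eInt μ u = eInt μ v := by
  unfold eInt
  congr 2
  · exact lintegral_congr_ae (h.mono fun x hx => by simp only [hx])
  · exact lintegral_congr_ae (h.mono fun x hx => by simp only [hx])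

lemma eInt_coe {d : ℕ} {μ : Measure (Euc d)} {g : Euc d → ℝ} (hg : Integrable g μ) :
    eInt μ (fun x => (g x : EReal)) = ((∫ x, g x ∂μ : ℝ) : EReal) := by
  unfold eInt
  have h1 : ∫⁻ x, ENNReal.ofReal (g x) ∂μ ≠ ⊤ := hg.lintegral_lt_top.ne
  have h2 : ∫⁻ x, ENNReal.ofReal (-g x) ∂μ ≠ ⊤ := hg.neg.lintegral_lt_top.ne
  rw [integral_eq_lintegral_pos_part_sub_lintegral_neg_part hg]
  simp only [← EReal.coe_neg, erealPos_coe]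
  rw [EReal.coe_sub, EReal.coe_ennreal_toReal h1, EReal.coe_ennreal_toReal h2]

lemma ae_mem_of_compl_null {d : ℕ} {μ : Measure (Euc d)} {L : Set (Euc d)} (h : μ Lᶜ = 0) :
    ∀ᵐ x ∂μ, x ∈ L := by
  rwa [ae_iff]

lemma integrable_of_continuousOn {d : ℕ} {μ : Measure (Euc d)} [IsFiniteMeasure μ]
    {L : Set (Euc d)} (hL : IsCompact L) (h : μ Lᶜ = 0) {g : Euc d → ℝ} (hg : ContinuousOn g L) :
    Integrable g μ := by
  have := hg.integrableOn_compact (μ := μ) hL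
  rwa [IntegrableOn, Measure.restrict_eq_self_of_ae_mem (ae_mem_of_compl_null h)] at this

lemma eInt_eq_integral {d : ℕ} {μ : Measure (Euc d)} [IsFiniteMeasure μ]
    {L : Set (Euc d)} (hL : IsCompact L) (h : μ Lᶜ = 0) {g : Euc d → ℝ} (hg : ContinuousOn g L)
    {u : Euc d → EReal} (hu : ∀ y ∈ L, u y = (g y : EReal)) :
    eInt μ u = ((∫ x, g x ∂μ : ℝ) : EReal) := by
  rw [← eInt_coe (integrable_of_continuousOn hL h hg)]
  exact eInt_congr_ae ((ae_mem_of_compl_null h).mono hu)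

lemma SubMean.affine {d : ℕ} {g : Euc d → ℝ} {y : Euc d} (h : SubMean g y) {C : ℝ} (hC : 0 ≤ C)
    (M : ℝ) : SubMean (fun z => C * g z - M) y := by
  filter_upwards [h, self_mem_nhdsWithin] with r hr hr0
  refine ⟨by have := hr.1; fun_prop, ?_⟩
  rw [average_affine hr0 hr.1]
  have := mul_le_mul_of_nonneg_left hr.2 hC
  linarith

lemma subMean_norm_sq {d : ℕ} (hd : 0 < d) (y : Euc d) : SubMean (fun z => ‖z‖ ^ 2) y := by
  filter_upwards [self_mem_nhdsWithin] with r hr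
  exact ⟨by fun_prop, norm_sq_le_average hd y hr⟩

lemma kap_dist_continuousOn {d : ℕ} (c : Euc d) {s : Set (Euc d)} (hs : c ∉ s) :
    ContinuousOn (fun z => kap d (dist z c)) s :=
  (kap_continuousOn d).comp (f := fun z : Euc d => dist z c) (by fun_prop) fun z hz =>
    dist_pos.2 fun h => hs (h ▸ hz)

lemma subMean_kap {d : ℕ} (hd : 0 < d) {c y : Euc d} (h : y ≠ c) :
    SubMean (fun z => kap d (dist z c)) y := by
  filter_upwards [self_mem_nhdsWithin, eventually_nhdsWithin_of_eventually_nhds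
    (gt_mem_nhds (dist_pos.2 h))] with r hr hrx
  refine ⟨kap_dist_continuousOn c fun hc => ?_, (kap_average hd c y hr hrx).le⟩
  rw [mem_closedBall, dist_comm] at hc
  exact absurd hrx (not_lt.2 hc)

lemma subMean_neg_kap {d : ℕ} (hd : 0 < d) {c y : Euc d} (h : y ≠ c) :
    SubMean (fun z => -kap d (dist z c)) y := by
  filter_upwards [self_mem_nhdsWithin, eventually_nhdsWithin_of_eventually_nhds
    (gt_mem_nhds (dist_pos.2 h))] with r hr hrx
  have hc : ContinuousOn (fun z => kap d (dist z c)) (closedBall y r) := by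
    refine kap_dist_continuousOn c fun hc => ?_
    rw [mem_closedBall, dist_comm] at hc
    exact absurd hrx (not_lt.2 hc)
  refine ⟨hc.neg, ?_⟩
  have := average_affine hr hc (-1) 0
  rw [kap_average hd c y hr hrx]
  simp only [neg_mul, one_mul, sub_zero] at this
  rw [this]

lemma tendsto_kap_zero {d : ℕ} (hd : 0 < d) (hd1 : d ≠ 1) :
    Tendsto (kap d) (𝓝[>] 0) atBot := by
  unfold kap
  simp only [hd1, if_false]
  split_ifs with h2
  · exact Real.tendsto_log_nhdsGT_zero
  · have h3 : (3 : ℝ) ≤ d := by exact_mod_cast (by omega : 3 ≤ d)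
    exact tendsto_neg_atTop_atBot.comp (tendsto_rpow_neg_nhdsGT_zero (by linarith))

lemma Kker_upperSemicontinuous {d : ℕ} (hd : 0 < d) (x : Euc d) :
    UpperSemicontinuous fun y => Kker d y x := by
  intro y
  by_cases h1 : d = 1
  · subst h1
    simp only [Kker_one]
    refine ContinuousAt.upperSemicontinuousAt ?_
    simp only [kap, if_true]
    exact continuous_coe_real_ereal.continuousAt.comp (by fun_prop)
  by_cases hy : y = x
  · subst hy
    intro a ha
    replace ha : Kker d y y < a := ha
    rw [Kker_self h1] at ha
    obtain ⟨b, hb⟩ := EReal.lt_iff_exists_real_btwn.1 ha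
    have h2 := (tendsto_kap_zero hd h1).eventually (eventually_lt_atBot b)
    obtain ⟨ε, hε, h3⟩ := mem_nhdsGT_iff_exists_Ioo_subset.1 h2
    filter_upwards [ball_mem_nhds y hε] with z hz
    by_cases hzy : z = y
    · rw [hzy, Kker_self h1]; exact ha
    · rw [Kker_of_ne hzy]
      exact (EReal.coe_lt_coe_iff.2 (h3 ⟨dist_pos.2 hzy, hz⟩)).trans hb.2
  · refine ContinuousAt.upperSemicontinuousAt ?_
    have h3 : ContinuousAt (fun z => ((kap d (dist z x) : ℝ) : EReal)) y :=
      continuous_coe_real_ereal.continuousAt.comp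
        ((kap_dist_continuousOn x (s := {x}ᶜ) (by simp)).continuousAt
          (isOpen_compl_singleton.mem_nhds hy))
    refine h3.congr ?_
    filter_upwards [isOpen_compl_singleton.mem_nhds (x := y) hy] with z hz
    exact (Kker_of_ne hz).symm

theorem sbhOn_Kker {d : ℕ} (hd : 0 < d) (x : Euc d) (O : Set (Euc d)) :
    SbhOn (fun y => Kker d y x) O := by
  refine sbhOn_of_touching hd ((Kker_upperSemicontinuous hd x).upperSemicontinuousOn O) ?_ ?_
  · intro y _
    unfold Kker
    split_ifs
    · exact EReal.coe_lt_top _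
    · exact bot_lt_top
    · exact EReal.coe_lt_top _
    · exact EReal.coe_lt_top _
  intro y _
  by_cases hy : y = x
  · subst hy
    by_cases h1 : d = 1
    · subst h1
      refine Or.inr ⟨fun _ => 0, by simp [Kker], ?_, ?_⟩
      · filter_upwards with r
        exact ⟨continuousOn_const, by simp⟩
      · filter_upwards with z
        simp [Kker]
    · exact Or.inl (Kker_self h1 y)
  · refine Or.inr ⟨_, Kker_of_ne hy, subMean_kap hd hy, ?_⟩
    filter_upwards [isOpen_compl_singleton.mem_nhds (x := y) hy] with z hz
    exact (Kker_of_ne hz).ge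

/-- Balayage of a measure transfers to `-K_x` when a strict level set of a subharmonic function
separates the supports from `x`. -/
theorem eInt_Kker_eq_of_separating {d : ℕ} (hd : 0 < d) {O L : Set (Euc d)} (hO : IsOpen O)
    {δ ω : Measure (Euc d)} [IsFiniteMeasure δ] [IsFiniteMeasure ω] (hL : IsCompact L) (hLO : L ⊆ O)
    (hδL : δ Lᶜ = 0) (hωL : ω Lᶜ = 0)
    (hbal : ∀ u : Euc d → EReal, SbhOn u O → eInt δ u ≤ eInt ω u) (x : Euc d)
    {g : Euc d → ℝ} (hg : ∀ y ∈ O, ContinuousAt g y) (hsub : ∀ y ∈ O, SubMean g y)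
    {g0 g1 η : ℝ} (hgL : ∀ y ∈ L, g y ≤ g1) (h01 : g1 < g0) (hη : 0 < η)
    (hfar : ∀ y ∈ O, g y ≤ g0 → η ≤ dist y x) :
    eInt δ (fun y => Kker d y x) = eInt ω (fun y => Kker d y x) := by
  obtain ⟨R, hR⟩ := hL.isBounded.subset_closedBall x
  set R' := max R η with hR'
  have hmono := (kap_strictMonoOn hd).monotoneOn
  set B := -kap d η with hB
  set b := -kap d R' with hb
  have hbB : b ≤ B := neg_le_neg (hmono hη (hη.trans_le (le_max_right R η)) (le_max_right R η))
  set C := (B - b) / (g0 - g1) with hC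
  have hg01 : 0 < g0 - g1 := sub_pos.2 h01
  have hC0 : 0 ≤ C := div_nonneg (sub_nonneg.2 hbB) hg01.le
  have hCe : C * (g0 - g1) = B - b := by rw [hC]; field_simp
  set M := C * g1 - b with hM
  set q : Euc d → ℝ := fun y => -kap d (max (dist y x) η) with hq
  have hqc : Continuous q := by
    refine ((kap_continuousOn d).comp_continuous (f := fun y : Euc d => max (dist y x) η)
      (by fun_prop) fun y => ?_).neg
    exact hη.trans_le (le_max_right _ _)
  have hxL : x ∉ L := fun hx => by
    have := hfar x (hLO hx) ((hgL x hx).trans h01.le)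
    rw [dist_self] at this; linarith
  have hqB : ∀ y, q y ≤ B := fun y =>
    neg_le_neg (hmono hη (hη.trans_le (le_max_right _ _)) (le_max_right _ _))
  set v : Euc d → ℝ := fun y => max (C * g y - M) (q y) with hv
  have hvs : SbhOn (fun y => (v y : EReal)) O := by
    refine sbhOn_of_touching hd ?_ (fun y _ => EReal.coe_lt_top _) ?_
    · intro y hy
      refine ContinuousWithinAt.upperSemicontinuousWithinAt ?_
      have := hg y hy
      exact (continuous_coe_real_ereal.continuousAt.comp
        (((this.const_mul C).sub continuousAt_const).max hqc.continuousAt)).continuousWithinAt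
    · intro y hy
      refine Or.inr ?_
      by_cases hgy : q y ≤ C * g y - M
      · refine ⟨_, by rw [hv]; simp only [max_eq_left hgy], (hsub y hy).affine hC0 M, ?_⟩
        filter_upwards with z
        exact EReal.coe_le_coe_iff.2 (le_max_left _ _)
      · have hlt : g y < g0 := by
          by_contra! hcon
          have := mul_le_mul_of_nonneg_left hcon hC0
          have := hqB y
          apply hgy; linarith
        have hηy := hfar y hy hlt.le
        have hyx : y ≠ x := fun h => by rw [h, dist_self] at hηy; linarith
        refine ⟨fun z => -kap d (dist z x), ?_, subMean_neg_kap hd hyx, ?_⟩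
        · rw [show v y = q y from max_eq_right (not_le.1 hgy).le]
          simp only [hq, max_eq_left hηy]
        · filter_upwards [hO.mem_nhds hy, (hg y hy).eventually (gt_mem_nhds hlt)] with z hz hz0
          rw [EReal.coe_le_coe_iff]
          refine le_trans ?_ (le_max_right _ _)
          simp only [hq, max_eq_left (hfar z hz hz0.le), le_refl]
  have hvL : ∀ y ∈ L, v y = -kap d (dist y x) := by
    intro y hy
    have h1 := hgL y hy
    have hηy := hfar y (hLO hy) (h1.trans h01.le)
    simp only [hv, hq, max_eq_left hηy]
    refine max_eq_right ?_
    have h2 := mul_le_mul_of_nonneg_left h1 hC0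
    have h3 : kap d (dist y x) ≤ kap d R' :=
      hmono (hη.trans_le hηy) (hη.trans_le (le_max_right R η)) ((hR hy).trans (le_max_left _ _))
    linarith
  have hkc : ContinuousOn (fun y => kap d (dist y x)) L := kap_dist_continuousOn x hxL
  have hK : ∀ y ∈ L, Kker d y x = ((kap d (dist y x) : ℝ) : EReal) := fun y hy =>
    Kker_of_ne fun h => hxL (h ▸ hy)
  have h1 := hbal _ (sbhOn_Kker hd x O)
  have h2 := hbal _ hvs
  rw [eInt_eq_integral hL hδL hkc hK, eInt_eq_integral hL hωL hkc hK] at h1 ⊢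
  rw [eInt_eq_integral hL hδL hkc.neg fun y hy => congrArg _ (hvL y hy),
    eInt_eq_integral hL hωL hkc.neg fun y hy => congrArg _ (hvL y hy)] at h2
  rw [EReal.coe_le_coe_iff] at h1 h2
  simp only [Pi.neg_apply, integral_neg] at h2
  exact congrArg _ (le_antisymm h1 (by linarith))

theorem exists_compact_of_balayage {d : ℕ} (hd : 0 < d) {O : Set (Euc d)} (hO : IsOpen O)
    {δ ω : Measure (Euc d)} (hδ : MeasCompIn δ O) (hω : MeasCompIn ω O)
    (hbal : ∀ u : Euc d → EReal, SbhOn u O → eInt δ u ≤ eInt ω u) :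
    ∃ S : Set (Euc d), IsCompact S ∧ S ⊆ O ∧
        (∀ x ∈ O, eInt δ (fun y => Kker d y x) ≤ eInt ω (fun y => Kker d y x)) ∧
        (∀ x ∈ O \ S, eInt δ (fun y => Kker d y x) = eInt ω (fun y => Kker d y x)) := by
  have : IsFiniteMeasure δ := ⟨hδ.2.2.2⟩
  have : IsFiniteMeasure ω := ⟨hω.2.2.2⟩
  set L := msupp δ ∪ msupp ω with hLdef
  have hL : IsCompact L := hδ.1.union hω.1
  have hLO : L ⊆ O := union_subset hδ.2.1 hω.2.1
  have hδL : δ Lᶜ = 0 := measure_mono_null (compl_subset_compl.2 subset_union_left) hδ.2.2.1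
  have hωL : ω Lᶜ = 0 := measure_mono_null (compl_subset_compl.2 subset_union_right) hω.2.2.1
  obtain ⟨R, hR0, hR⟩ := hL.isBounded.subset_closedBall_lt 0 0
  obtain ⟨ρ, hρ, hρO⟩ := hL.exists_thickening_subset_open hO hLO
  have hLa : ∀ y ∈ L, ∀ a ∉ O, ρ ≤ dist y a := by
    intro y hy a ha
    by_contra! hcon
    exact ha (hρO (mem_thickening_iff.2 ⟨y, hy, by rwa [dist_comm]⟩))
  refine ⟨{x ∈ closedBall 0 R | ∀ a ∉ O, ρ ≤ dist x a}, ?_, ?_, fun x _ => hbal _ (sbhOn_Kker hd x O),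
    ?_⟩
  · have hc : IsClosed (⋂ a ∈ Oᶜ, {x : Euc d | ρ ≤ dist x a}) :=
      isClosed_biInter fun a _ => isClosed_le continuous_const (by fun_prop)
    have he : {x ∈ closedBall (0 : Euc d) R | ∀ a ∉ O, ρ ≤ dist x a}
        = closedBall 0 R ∩ ⋂ a ∈ Oᶜ, {x : Euc d | ρ ≤ dist x a} := by
      ext x
      simp
    rw [he]
    exact (isCompact_closedBall (0 : Euc d) R).inter_right hc
  · rintro x ⟨_, hx⟩
    by_contra hcon
    have := hx x hcon
    rw [dist_self] at this
    linarith
  rintro x ⟨hxO, hxS⟩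
  by_cases hxR : ‖x‖ ≤ R
  · obtain ⟨a, haO, hxa⟩ : ∃ a ∉ O, dist x a < ρ := by
      by_contra! hcon
      exact hxS ⟨by simpa using hxR, hcon⟩
    have hmono := kap_strictMonoOn hd
    have hpos : ∀ y ∈ O, 0 < dist y a := fun y hy => dist_pos.2 fun h => haO (h ▸ hy)
    have hs : 0 < (dist x a + ρ) / 2 := by have := hpos x hxO; linarith
    refine eInt_Kker_eq_of_separating hd hO hL hLO hδL hωL hbal x
      (g := fun y => -kap d (dist y a)) (g0 := -kap d ((dist x a + ρ) / 2)) (g1 := -kap d ρ)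
      (η := (ρ - dist x a) / 2) ?_ ?_ ?_ ?_ (by linarith) ?_
    · intro y hy
      exact ((kap_dist_continuousOn a haO).continuousAt (hO.mem_nhds hy)).neg
    · intro y hy
      exact subMean_neg_kap hd fun h => haO (h ▸ hy)
    · intro y hy
      exact neg_le_neg (hmono.monotoneOn hρ (hpos y (hLO hy)) (hLa y hy a haO))
    · exact neg_lt_neg (hmono hs hρ (by linarith))
    · intro y hy hle
      have h1 := (hmono.le_iff_le hs (hpos y hy)).1 (neg_le_neg_iff.1 hle)
      have := dist_triangle y x a
      linarith
  · push Not at hxR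
    refine eInt_Kker_eq_of_separating hd hO hL hLO hδL hωL hbal x
      (g := fun y => ‖y‖ ^ 2) (g0 := ((R + ‖x‖) / 2) ^ 2) (g1 := R ^ 2)
      (η := (‖x‖ - R) / 2) ?_ ?_ ?_ ?_ (by linarith) ?_
    · intro y _
      fun_prop
    · intro y _
      exact subMean_norm_sq hd y
    · intro y hy
      have : ‖y‖ ≤ R := by simpa using hR hy
      gcongr
    · gcongr
      linarith
    · intro y _ hle
      have h1 := abs_le_of_sq_le_sq' hle (by positivity)
      have := norm_sub_norm_le x y
      rw [dist_comm, dist_eq_norm]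
      linarith

/-- Evaluation of a polynomial in the coordinates of a point. -/
def polyEval {d : ℕ} (p : MvPolynomial (Fin d) ℝ) (y : Euc d) : ℝ :=
  MvPolynomial.eval (fun i => y i) p

lemma polyEval_contDiff {d : ℕ} {n : WithTop ℕ∞} (p : MvPolynomial (Fin d) ℝ) :
    ContDiff ℝ n (polyEval p) := by
  unfold polyEval
  induction p using MvPolynomial.induction_on with
  | C a => simpa using contDiff_const
  | add p q hp hq => simpa using hp.add hq
  | mul_X p i hp =>
    have : ContDiff ℝ n fun y : Euc d => y i := by fun_prop
    simpa using hp.mul this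

lemma polyEval_fderiv {d : ℕ} (p : MvPolynomial (Fin d) ℝ) (i : Fin d) (y : Euc d) :
    fderiv ℝ (polyEval p) y (EuclideanSpace.single i 1) = polyEval (MvPolynomial.pderiv i p) y := by
  have hdiff : ∀ q : MvPolynomial (Fin d) ℝ, DifferentiableAt ℝ (polyEval q) y := fun q =>
    (polyEval_contDiff (n := 1) q).differentiable (by norm_num) y
  induction p using MvPolynomial.induction_on with
  | C a =>
    have : polyEval (d := d) (MvPolynomial.C a) = fun _ => a := by ext; simp [polyEval]
    rw [this]
    simp [polyEval]
  | add p q hp hq =>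
    have : polyEval (p + q) = fun y => polyEval p y + polyEval q y := by ext; simp [polyEval]
    rw [this, fderiv_fun_add (hdiff p) (hdiff q), add_apply, hp, hq]
    simp [polyEval]
  | mul_X p j hp =>
    have : polyEval (p * MvPolynomial.X j) = fun y => polyEval p y * y j := by
      ext; simp [polyEval]
    have hj : HasFDerivAt (fun y : Euc d => y j)
        (EuclideanSpace.proj j : Euc d →L[ℝ] ℝ) y :=
      (EuclideanSpace.proj (𝕜 := ℝ) j : Euc d →L[ℝ] ℝ).hasFDerivAt
    rw [this, HasFDerivAt.fderiv ((hdiff p).hasFDerivAt.fun_mul hj)]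
    simp only [add_apply, smul_apply, hp, smul_eq_mul]
    by_cases hij : j = i
    · subst hij; simp [polyEval]
    · simp [polyEval, MvPolynomial.pderiv_X, hij]

/-- The Laplacian on polynomials. -/
def polyLap (d : ℕ) : MvPolynomial (Fin d) ℝ →ₗ[ℝ] MvPolynomial (Fin d) ℝ :=
  ∑ i, (MvPolynomial.pderiv i).toLinearMap ∘ₗ (MvPolynomial.pderiv i).toLinearMap

lemma polyLap_apply {d : ℕ} (p : MvPolynomial (Fin d) ℝ) :
    polyLap d p = ∑ i, MvPolynomial.pderiv i (MvPolynomial.pderiv i p) := by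
  simp [polyLap]

lemma le_average_polyEval {d : ℕ} (hd : 0 < d) {p : MvPolynomial (Fin d) ℝ} (hp : polyLap d p = 0)
    (x : Euc d) {r : ℝ} (hr : 0 < r) : polyEval p x ≤ ⨍ y in closedBall x r, polyEval p y := by
  refine le_average_of_laplacian_nonneg hd hr (polyEval_contDiff p)
    (g := fun i => polyEval (MvPolynomial.pderiv i p)) (fun i => polyEval_contDiff _)
    (fun i y => polyEval_fderiv p i y) fun y _ => ?_
  simp only [polyEval_fderiv]
  have : polyEval (polyLap d p) y = 0 := by rw [hp]; simp [polyEval]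
  rw [polyLap_apply] at this
  simpa [polyEval] using this.ge

lemma harmOn_polyEval {d : ℕ} (hd : 0 < d) {p : MvPolynomial (Fin d) ℝ} (hp : polyLap d p = 0)
    (O : Set (Euc d)) : HarmOn (polyEval p) O := by
  refine ⟨(polyEval_contDiff (n := 0) p).continuous.continuousOn, fun x r hr _ =>
    le_antisymm (le_average_polyEval hd hp x hr) ?_⟩
  have h := le_average_polyEval hd (p := -p) (by rw [map_neg, hp, neg_zero]) x hr
  have e : polyEval (-p) = fun y => -polyEval p y := by ext; simp [polyEval]
  rw [e] at h
  simp only [average_eq, integral_neg, smul_neg] at h ⊢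
  linarith

lemma polyEval_nonpos_of_sphere {d : ℕ} (hd : 0 < d) {p : MvPolynomial (Fin d) ℝ}
    (hp : polyLap d p = 0) {x : Euc d} {r : ℝ} (hr : 0 < r)
    (hs : ∀ y ∈ sphere x r, polyEval p y ≤ 0) : ∀ y ∈ closedBall x r, polyEval p y ≤ 0 := by
  have hc : Continuous (polyEval p) := (polyEval_contDiff (n := 0) p).continuous
  have hsub : SbhOn (fun y => (polyEval p y : EReal)) univ := by
    refine sbhOn_of_touching hd ?_ (fun y _ => EReal.coe_lt_top _) fun y _ => Or.inr
      ⟨polyEval p, rfl, ?_, Eventually.of_forall fun _ => le_rfl⟩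
    · exact (continuous_coe_real_ereal.comp hc).upperSemicontinuous.upperSemicontinuousOn _
    · filter_upwards [self_mem_nhdsWithin] with s hs
      exact ⟨hc.continuousOn, le_average_polyEval hd hp y hs⟩
  intro y hy
  have := hsub.2.2 x r hr (subset_univ _) (fun _ => 0) continuousOn_const
    ⟨continuousOn_const, fun z s hs _ => by
      rw [setAverage_const (measure_closedBall_pos _ _ hs).ne' measure_closedBall_lt_top.ne]⟩
    (fun z hz => EReal.coe_le_coe_iff.2 (hs z hz)) y hy
  exact EReal.coe_le_coe_iff.1 this

lemma eq_zero_of_polyEval_ball {d : ℕ} {p : MvPolynomial (Fin d) ℝ} {x : Euc d} {r : ℝ} (hr : 0 < r)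
    (h : ∀ y ∈ ball x r, polyEval p y = 0) : p = 0 := by
  have hU : IsOpen (WithLp.toLp 2 ⁻¹' ball x r : Set (Fin d → ℝ)) :=
    isOpen_ball.preimage (PiLp.continuous_toLp 2 _)
  obtain ⟨ε, hε, hεb⟩ := Metric.isOpen_iff.1 hU (WithLp.ofLp x) (by simpa using hr)
  refine MvPolynomial.funext_set (fun i => ball (x i) ε) (fun i => ?_) fun y hy => ?_
  · rw [Real.ball_eq_Ioo]
    exact Ioo_infinite (by linarith)
  · have : y ∈ ball (WithLp.ofLp x) ε := by
      rw [ball_pi _ hε]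
      exact hy
    have := h _ (hεb this)
    simpa [polyEval] using this

lemma totalDegree_pderiv_add_one_le {d : ℕ} (p : MvPolynomial (Fin d) ℝ) (i : Fin d) :
    (MvPolynomial.pderiv i p).totalDegree ≤ p.totalDegree - 1 := by
  refine Finset.sup_le fun m hm => ?_
  rw [MvPolynomial.mem_support_iff, MvPolynomial.coeff_pderiv] at hm
  have h1 := MvPolynomial.le_totalDegree (MvPolynomial.mem_support_iff.2 (left_ne_zero_of_mul hm))
  rw [Finsupp.sum_add_index' (fun _ => rfl) (fun _ _ _ => rfl),
    Finsupp.sum_single_index rfl] at h1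
  omega

lemma totalDegree_polyLap_le {d : ℕ} (p : MvPolynomial (Fin d) ℝ) :
    (polyLap d p).totalDegree ≤ p.totalDegree - 2 := by
  rw [polyLap_apply]
  refine MvPolynomial.totalDegree_finsetSum_le fun i _ => ?_
  have h1 := totalDegree_pderiv_add_one_le p i
  have h2 := totalDegree_pderiv_add_one_le (MvPolynomial.pderiv i p) i
  omega

/-- The polynomial Dirichlet problem on a ball. -/
theorem exists_harmonic_polynomial {d : ℕ} (hd : 0 < d) (x : Euc d) {r : ℝ} (hr : 0 < r)
    (f : MvPolynomial (Fin d) ℝ) : ∃ H : MvPolynomial (Fin d) ℝ, polyLap d H = 0 ∧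
      ∀ y ∈ sphere x r, polyEval H y = polyEval f y := by
  set P : MvPolynomial (Fin d) ℝ := ∑ i, (MvPolynomial.X i - MvPolynomial.C (x i)) ^ 2
    - MvPolynomial.C (r ^ 2) with hP
  have hPe : ∀ y, polyEval P y = dist y x ^ 2 - r ^ 2 := by
    intro y
    rw [EuclideanSpace.dist_eq, Real.sq_sqrt (Finset.sum_nonneg fun i _ => sq_nonneg _)]
    simp [hP, polyEval, Real.dist_eq, sq_abs]
  have hP0 : P ≠ 0 := by
    intro h
    have h1 := hPe x
    rw [h] at h1
    simp [polyEval] at h1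
    exact hr.ne' h1
  have hPd : P.totalDegree ≤ 2 := by
    refine (MvPolynomial.totalDegree_sub_C_le _ _).trans
      (MvPolynomial.totalDegree_finsetSum_le fun i _ => ?_)
    refine (MvPolynomial.totalDegree_pow _ _).trans ?_
    have := MvPolynomial.totalDegree_sub_C_le (MvPolynomial.X i) (x i)
    rw [MvPolynomial.totalDegree_X] at this
    omega
  set k := f.totalDegree
  have hmem : ∀ q ∈ MvPolynomial.restrictTotalDegree (Fin d) ℝ k,
      (polyLap d ∘ₗ LinearMap.mulLeft ℝ P) q ∈ MvPolynomial.restrictTotalDegree (Fin d) ℝ k := by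
    intro q hq
    rw [MvPolynomial.mem_restrictTotalDegree] at hq ⊢
    have h1 := totalDegree_polyLap_le (P * q)
    have h2 := MvPolynomial.totalDegree_mul P q
    simp only [LinearMap.comp_apply, LinearMap.mulLeft_apply]
    omega
  have hinj : Function.Injective ((polyLap d ∘ₗ LinearMap.mulLeft ℝ P).restrict hmem) := by
    rw [injective_iff_map_eq_zero]
    rintro ⟨q, hq⟩ h0
    have h1 : polyLap d (P * q) = 0 := congrArg Subtype.val h0
    have hs : ∀ y ∈ sphere x r, polyEval (P * q) y = 0 := by
      intro y hy
      have : polyEval (P * q) y = polyEval P y * polyEval q y := by simp [polyEval]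
      rw [this, hPe, mem_sphere.1 hy]; ring
    have hle := polyEval_nonpos_of_sphere hd h1 hr fun y hy => (hs y hy).le
    have e : polyEval (-(P * q)) = fun y => -polyEval (P * q) y := by ext; simp [polyEval]
    have hge := polyEval_nonpos_of_sphere hd (p := -(P * q)) (x := x) (by rw [map_neg, h1, neg_zero]) hr
      fun y hy => by rw [e]; simp only [hs y hy, neg_zero, le_refl]
    rw [e] at hge
    have := eq_zero_of_polyEval_ball (p := P * q) hr fun y hy =>
      le_antisymm (hle y (ball_subset_closedBall hy))
        (neg_nonpos.1 (hge y (ball_subset_closedBall hy)))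
    exact Subtype.ext ((mul_eq_zero.1 this).resolve_left hP0)
  obtain ⟨⟨q, hq⟩, hqf⟩ := LinearMap.injective_iff_surjective.1 hinj ⟨polyLap d f, by
    rw [MvPolynomial.mem_restrictTotalDegree]
    exact (totalDegree_polyLap_le f).trans (Nat.sub_le _ _)⟩
  have h1 : polyLap d (P * q) = polyLap d f := congrArg Subtype.val hqf
  refine ⟨f - P * q, by rw [map_sub, h1, sub_self], fun y hy => ?_⟩
  have : polyEval (f - P * q) y = polyEval f y - polyEval P y * polyEval q y := by simp [polyEval]
  rw [this, hPe, mem_sphere.1 hy]; ring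

/-- Surface measure on the unit sphere. -/
abbrev sphMeas (d : ℕ) : Measure (sphere (0 : Euc d) 1) := (volume : Measure (Euc d)).toSphere

/-- Total surface measure of the unit sphere. -/
def sphMass (d : ℕ) : ℝ := (sphMeas d).real univ

lemma sphMass_pos {d : ℕ} (hd : 0 < d) : 0 < sphMass d := by
  have : Nonempty (Fin d) := ⟨⟨0, hd⟩⟩
  unfold sphMass sphMeas
  rw [Measure.toSphere_real_apply_univ, finrank_euclideanSpace_fin]
  have : 0 < volume.real (ball (0 : Euc d) 1) :=
    ENNReal.toReal_pos (measure_ball_pos _ _ one_pos).ne' measure_ball_lt_top.ne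
  positivity

/-- The unnormalized spherical mean. -/
def sphInt {d : ℕ} (v : Euc d → ℝ) (x : Euc d) (r : ℝ) : ℝ :=
  ∫ ζ : sphere (0 : Euc d) 1, v (x + r • (ζ : Euc d)) ∂(sphMeas d)

lemma integrable_polar {d : ℕ} {f : Euc d → ℝ} (hf : Integrable f) :
    Integrable (fun p : sphere (0 : Euc d) 1 × Ioi (0 : ℝ) => f (p.2.1 • (p.1 : Euc d)))
      ((sphMeas d).prod (Measure.volumeIoiPow (d - 1))) := by
  have h := (volume : Measure (Euc d)).measurePreserving_homeomorphUnitSphereProd.integrable_comp_emb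
    (g := fun p => f (p.2.1 • (p.1 : Euc d))) (Homeomorph.measurableEmbedding _)
  rw [finrank_euclideanSpace_fin] at h
  rw [← h]
  have h2 : Integrable (f ∘ (Subtype.val : ({0}ᶜ : Set (Euc d)) → Euc d))
      (Measure.comap Subtype.val volume) := by
    rw [← integrableOn_iff_comap_subtypeVal (measurableSet_singleton _).compl]
    exact hf.integrableOn
  refine h2.congr (Eventually.of_forall fun y => ?_)
  have : (‖(y : Euc d)‖) ≠ 0 := norm_ne_zero_iff.2 y.2
  simp [smul_smul, this]

lemma integral_volumeIoiPow {n : ℕ} (g : ℝ → ℝ) :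
    ∫ x : Ioi (0 : ℝ), g x ∂(Measure.volumeIoiPow n) = ∫ y in Ioi (0 : ℝ), y ^ n * g y := by
  simp only [Measure.volumeIoiPow, ENNReal.ofReal]
  rw [integral_withDensity_eq_integral_smul,
    integral_subtype_comap measurableSet_Ioi fun a ↦ Real.toNNReal (a ^ n) • g a,
    setIntegral_congr_fun measurableSet_Ioi fun x hx ↦ ?_]
  · simp only [NNReal.smul_def, Real.coe_toNNReal _ (pow_nonneg hx.out.le _), smul_eq_mul]
  · exact (measurable_subtype_coe.pow_const _).real_toNNReal

lemma integrable_volumeIoiPow_iff {n : ℕ} {g : ℝ → ℝ} :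
    Integrable (fun x : Ioi (0 : ℝ) => g x) (Measure.volumeIoiPow n)
      ↔ IntegrableOn (fun y => y ^ n * g y) (Ioi 0) := by
  rw [integrableOn_iff_comap_subtypeVal measurableSet_Ioi, Function.comp_def, Measure.volumeIoiPow,
    integrable_withDensity_iff_integrable_smul', integrable_congr]
  · refine .of_forall ?_
    rintro ⟨x, hx : 0 < x⟩
    simp (disch := positivity) [ENNReal.toReal_ofReal]
  · fun_prop
  · simp

theorem integral_polar {d : ℕ} {f : Euc d → ℝ} (hd : 0 < d) (hf : Integrable f) :
    ∫ x, f x = ∫ r in Ioi (0 : ℝ), r ^ (d - 1) * sphInt f 0 r := by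
  have : Nonempty (Fin d) := ⟨⟨0, hd⟩⟩
  rw [← integral_volumeIoiPow]
  have h := (volume : Measure (Euc d)).measurePreserving_homeomorphUnitSphereProd.integral_comp
    (g := fun p => f (p.2.1 • (p.1 : Euc d))) (Homeomorph.measurableEmbedding _)
  rw [finrank_euclideanSpace_fin, integral_prod_symm _ (integrable_polar hf)] at h
  simp only [sphInt, zero_add]
  rw [← h]
  have h2 := integral_subtype_comap (μ := volume) (measurableSet_singleton (0 : Euc d)).compl f
  rw [restrict_compl_singleton] at h2
  rw [← h2]
  refine integral_congr_ae (Eventually.of_forall fun y => ?_)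
  have : (‖(y : Euc d)‖) ≠ 0 := norm_ne_zero_iff.2 y.2
  simp [smul_smul, this]

theorem integrableOn_sphInt {d : ℕ} {f : Euc d → ℝ} (hf : Integrable f) :
    IntegrableOn (fun r => r ^ (d - 1) * sphInt f 0 r) (Ioi 0) := by
  rw [← integrable_volumeIoiPow_iff]
  simpa only [sphInt, zero_add] using (integrable_polar hf).integral_prod_right

lemma norm_smul_sphere {d : ℕ} (ζ : sphere (0 : Euc d) 1) {r : ℝ} (hr : 0 ≤ r) :
    ‖r • (ζ : Euc d)‖ = r := by
  rw [norm_smul, norm_eq_of_mem_sphere, mul_one, Real.norm_of_nonneg hr]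

lemma dist_add_smul_sphere {d : ℕ} (x : Euc d) (ζ : sphere (0 : Euc d) 1) {r : ℝ} (hr : 0 ≤ r) :
    dist (x + r • (ζ : Euc d)) x = r := by
  rw [dist_eq_norm, add_sub_cancel_left, norm_smul_sphere ζ hr]

/-- Solid mean values over all small balls imply spherical mean values. -/
theorem sphInt_of_average {d : ℕ} (hd : 0 < d) {h : Euc d → ℝ} {x : Euc d} {R : ℝ}
    (hc : ContinuousOn h (closedBall x R))
    (hm : ∀ s, 0 < s → s < R → h x = ⨍ y in closedBall x s, h y) {s : ℝ} (hs : 0 < s) (hsR : s < R) :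
    sphInt h x s = sphMass d * h x := by
  set cl : ℝ → ℝ := fun r => max 0 (min r R) with hcl
  have hcl0 : ∀ r, 0 ≤ cl r := fun r => le_max_left _ _
  have hclR : ∀ r, cl r ≤ R := fun r => max_le (hs.trans hsR).le (min_le_right _ _)
  have hcle : ∀ r, 0 ≤ r → r ≤ R → cl r = r := fun r h0 h1 => by
    simp only [hcl, min_eq_left h1, max_eq_right h0]
  set φ : ℝ → ℝ := fun r => ∫ ζ : sphere (0 : Euc d) 1, (h (x + cl r • (ζ : Euc d)) - h x) ∂(sphMeas d)
    with hφ
  have hφc : Continuous φ := by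
    have h1 : Continuous (fun r (ζ : sphere (0 : Euc d) 1) =>
        h (x + cl r • (ζ : Euc d)) - h x).uncurry := by
      refine Continuous.sub ?_ continuous_const
      refine hc.comp_continuous (f := fun p : ℝ × sphere (0 : Euc d) 1 => x + cl p.1 • (p.2 : Euc d))
        (by fun_prop) fun p => ?_
      rw [mem_closedBall, dist_add_smul_sphere _ _ (hcl0 _)]
      exact hclR _
    have h2 := continuous_parametric_integral_of_continuous (μ := sphMeas d) h1 isCompact_univ
    simpa only [Measure.restrict_univ] using h2
  have hzero : ∀ t, 0 < t → t < R → ∫ r in 0..t, r ^ (d - 1) * φ r = 0 := by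
    intro t ht htR
    have hct : ContinuousOn h (closedBall x t) := hc.mono (closedBall_subset_closedBall htR.le)
    set f : Euc d → ℝ := (closedBall 0 t).indicator fun y => h (x + y) - h x with hf
    have hfc : ContinuousOn (fun y => h (x + y) - h x) (closedBall (0 : Euc d) t) := by
      refine ContinuousOn.sub ?_ continuousOn_const
      refine hct.comp (f := fun y => x + y) (by fun_prop) fun y hy => ?_
      simpa [mem_closedBall, dist_eq_norm] using hy
    have hfi : Integrable f :=
      (hfc.integrableOn_compact (isCompact_closedBall _ _)).integrable_indicator
        measurableSet_closedBall
    have hf0 : ∫ y, f y = 0 := by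
      have e : ∀ y, f y = (closedBall x t).indicator (fun z => h z - h x) (x + y) := by
        intro y
        simp [hf, indicator, dist_eq_norm]
      simp only [e]
      rw [integral_add_left_eq_self (μ := volume)
        (fun z => (closedBall x t).indicator (fun z => h z - h x) z) x,
        integral_indicator measurableSet_closedBall]
      have h1 := average_affine ht hct 1 (h x)
      simp only [one_mul] at h1
      rw [← hm t ht htR, sub_self, setAverage_eq, smul_eq_mul, mul_eq_zero] at h1
      exact h1.resolve_left (inv_pos.2 (volume_real_closedBall_pos x ht)).ne'
    rw [integral_polar hd hfi] at hf0
    rw [intervalIntegral.integral_of_le ht.le]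
    refine Eq.trans ?_ hf0
    rw [← integral_indicator measurableSet_Ioc, ← integral_indicator measurableSet_Ioi]
    congr 1
    ext r
    by_cases hr0 : 0 < r
    · rw [indicator_of_mem (mem_Ioi.2 hr0)]
      by_cases hrt : r ≤ t
      · rw [indicator_of_mem (mem_Ioc.2 ⟨hr0, hrt⟩)]
        simp only [hφ, sphInt, hcle r hr0.le (hrt.trans htR.le), zero_add]
        congr 2
        ext ζ
        rw [hf, indicator_of_mem]
        rw [mem_closedBall_zero_iff, norm_smul_sphere _ hr0.le]
        exact hrt
      · rw [indicator_of_notMem fun h => hrt (mem_Ioc.1 h).2]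
        have : sphInt f 0 r = 0 := by
          simp only [sphInt]
          refine integral_eq_zero_of_ae (Eventually.of_forall fun ζ => ?_)
          refine indicator_of_notMem ?_ _
          rw [mem_closedBall_zero_iff, zero_add, norm_smul_sphere _ hr0.le]
          exact hrt
        rw [this, mul_zero]
    · rw [indicator_of_notMem fun h => hr0 (mem_Ioc.1 h).1,
        indicator_of_notMem fun h => hr0 (mem_Ioi.1 h)]
  have hψ : Continuous fun r => r ^ (d - 1) * φ r := by fun_prop
  have hder := hψ.deriv_integral _ 0 s
  have hev : (fun t => ∫ r in 0..t, r ^ (d - 1) * φ r) =ᶠ[𝓝 s] fun _ => 0 := by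
    filter_upwards [Ioo_mem_nhds hs hsR] with t ht
    exact hzero t ht.1 ht.2
  rw [hev.deriv_eq, deriv_const, eq_comm, mul_eq_zero] at hder
  have hφs := hder.resolve_left (pow_pos hs _).ne'
  simp only [hφ, hcle s hs.le hsR.le] at hφs
  have hi : Integrable (fun ζ : sphere (0 : Euc d) 1 => h (x + s • (ζ : Euc d))) (sphMeas d) := by
    have : Continuous fun ζ : sphere (0 : Euc d) 1 => h (x + s • (ζ : Euc d)) :=
      hc.comp_continuous (by fun_prop) fun ζ => by
        rw [mem_closedBall, dist_add_smul_sphere _ _ hs.le]; exact hsR.le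
    exact this.integrable_of_hasCompactSupport (HasCompactSupport.of_compactSpace _)
  rw [integral_sub hi (integrable_const _)] at hφs
  simp only [integral_const, smul_eq_mul] at hφs
  simp only [sphInt, sphMass]
  linarith

lemma sphInt_polyEval {d : ℕ} (hd : 0 < d) {p : MvPolynomial (Fin d) ℝ} (hp : polyLap d p = 0)
    (x : Euc d) {s : ℝ} (hs : 0 < s) : sphInt (polyEval p) x s = sphMass d * polyEval p x := by
  have h := harmOn_polyEval hd hp univ
  exact sphInt_of_average hd (R := s + 1) (h.1.mono (subset_univ _))
    (fun t ht _ => h.2 x t ht (subset_univ _)) hs (by linarith)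

lemma sphInt_kap {d : ℕ} (hd : 0 < d) {c x : Euc d} {s : ℝ} (hs : 0 < s) (hsx : s < dist x c) :
    sphInt (fun y => kap d (dist y c)) x s = sphMass d * kap d (dist x c) := by
  obtain ⟨R, hsR, hR⟩ := exists_between hsx
  refine sphInt_of_average hd (R := R) (kap_dist_continuousOn c fun hc => ?_)
    (fun t ht htR => kap_average hd c x ht (htR.trans hR)) hs hsR
  rw [mem_closedBall, dist_comm] at hc
  linarith

/-- A real upper semicontinuous function bounded above is a pointwise limit of continuous
majorants with the same upper bound. -/
lemma exists_continuous_tendsto_of_usc {K : Type*} [PseudoMetricSpace K] {v : K → ℝ}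
    (hv : UpperSemicontinuous v) {M : ℝ} (hM : ∀ z, v z ≤ M) :
    ∃ f : ℕ → C(K, ℝ), (∀ n z, v z ≤ f n z) ∧ (∀ n z, f n z ≤ M) ∧
      ∀ z, Tendsto (fun n => f n z) atTop (𝓝 (v z)) := by
  set g : ℕ → K → ℝ := fun n z => ⨆ y, (v y - n * dist z y) with hg
  have hle : ∀ (n : ℕ) z y, v y - n * dist z y ≤ M := fun n z y => by
    have : 0 ≤ (n : ℝ) * dist z y := by positivity
    linarith [hM y]
  have hbdd : ∀ (n : ℕ) z, BddAbove (range fun y => v y - n * dist z y) := fun n z =>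
    ⟨M, by rintro _ ⟨y, rfl⟩; exact hle n z y⟩
  have hlip : ∀ n : ℕ, LipschitzWith n (g n) := fun n => by
    refine LipschitzWith.of_le_add_mul _ fun z z' => ?_
    have : Nonempty K := ⟨z⟩
    refine ciSup_le fun y => ?_
    have h1 := le_ciSup (hbdd n z') y
    have h2 := mul_le_mul_of_nonneg_left (dist_triangle z' z y) (Nat.cast_nonneg (α := ℝ) n)
    rw [dist_comm z' z] at h2
    simp only [NNReal.coe_natCast]
    simp only [hg]
    linarith
  have hgv : ∀ n z, v z ≤ g n z := fun n z => by
    simpa using le_ciSup (hbdd n z) z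
  refine ⟨fun n => ⟨g n, (hlip n).continuous⟩, hgv, fun n z => ?_, fun z => ?_⟩
  · have : Nonempty K := ⟨z⟩
    exact ciSup_le (hle n z)
  · rw [tendsto_order]
    refine ⟨fun a ha => Eventually.of_forall fun n => ha.trans_le (hgv n z), fun a ha => ?_⟩
    obtain ⟨b, hvb, hba⟩ := exists_between ha
    obtain ⟨ρ, hρ, hball⟩ := Metric.eventually_nhds_iff_ball.1 (hv z b hvb)
    obtain ⟨n₀, hn₀⟩ := exists_nat_gt ((M - v z) / ρ)
    filter_upwards [eventually_ge_atTop n₀] with n hn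
    have : Nonempty K := ⟨z⟩
    refine (ciSup_le fun y => ?_).trans_lt hba
    by_cases hy : y ∈ ball z ρ
    · have : 0 ≤ (n : ℝ) * dist z y := by positivity
      linarith [hball y hy]
    · have h1 : ρ ≤ dist z y := by
        rw [dist_comm]; simpa using hy
      have h2 : (M - v z) / ρ < n := hn₀.trans_le (by exact_mod_cast hn)
      rw [div_lt_iff₀ hρ] at h2
      have h3 := mul_le_mul_of_nonneg_left h1 (Nat.cast_nonneg (α := ℝ) n)
      linarith [hM y]

/-- Polynomials are uniformly dense in the continuous functions on a sphere. -/
lemma exists_polyEval_near {d : ℕ} (x : Euc d) {r : ℝ} (hr : 0 < r)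
    (f : C(sphere (0 : Euc d) 1, ℝ)) {ε : ℝ} (hε : 0 < ε) :
    ∃ p : MvPolynomial (Fin d) ℝ, ∀ ζ : sphere (0 : Euc d) 1,
      |polyEval p (x + r • (ζ : Euc d)) - f ζ| < ε := by
  set X : Fin d → C(sphere (0 : Euc d) 1, ℝ) :=
    fun i => ⟨fun ζ => (x + r • (ζ : Euc d)) i, by fun_prop⟩ with hX
  have hev : ∀ (p : MvPolynomial (Fin d) ℝ) (ζ : sphere (0 : Euc d) 1),
      MvPolynomial.aeval X p ζ = polyEval p (x + r • (ζ : Euc d)) := by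
    intro p ζ
    unfold polyEval
    induction p using MvPolynomial.induction_on with
    | C a => simp
    | add p q hp hq => simp [hp, hq]
    | mul_X p i hp =>
      rw [map_mul, map_mul, ContinuousMap.mul_apply, hp]
      simp [hX]
  have hsep : (MvPolynomial.aeval (R := ℝ) X).range.SeparatesPoints := by
    intro ζ ξ hne
    obtain ⟨i, hi⟩ : ∃ i, (ζ : Euc d) i ≠ (ξ : Euc d) i := by
      by_contra! hcon
      exact hne (Subtype.ext (PiLp.ext hcon))
    refine ⟨X i, ⟨X i, ⟨MvPolynomial.X i, by simp⟩, rfl⟩, ?_⟩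
    simpa [hX, hr.ne'] using hi
  obtain ⟨⟨g, p, rfl⟩, hg⟩ := ContinuousMap.exists_mem_subalgebra_near_continuousMap_of_separatesPoints
    _ hsep f ε hε
  refine ⟨p, fun ζ => ?_⟩
  have h := (ContinuousMap.norm_lt_iff _ hε).1 hg ζ
  simpa [hev, Real.norm_eq_abs] using h

/-- Truncation from below of an extended-real function, as a real function. -/
def trunc {d : ℕ} (u : Euc d → EReal) (N : ℝ) (y : Euc d) : ℝ := (max (u y) ((-N : ℝ) : EReal)).toReal

lemma coe_trunc {d : ℕ} {u : Euc d → EReal} {y : Euc d} (h : u y < ⊤) (N : ℝ) :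
    (trunc u N y : EReal) = max (u y) ((-N : ℝ) : EReal) := by
  refine EReal.coe_toReal (max_lt h (EReal.coe_lt_top _)).ne ?_
  exact ((EReal.bot_lt_coe _).trans_le (le_max_right _ _)).ne'

lemma neg_le_trunc {d : ℕ} {u : Euc d → EReal} {y : Euc d} (h : u y < ⊤) (N : ℝ) :
    -N ≤ trunc u N y := by
  rw [← EReal.coe_le_coe_iff, coe_trunc h]
  exact le_max_right _ _

lemma le_trunc {d : ℕ} {u : Euc d → EReal} {y : Euc d} (h : u y < ⊤) (N : ℝ) :
    u y ≤ trunc u N y := by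
  rw [coe_trunc h]
  exact le_max_left _ _

lemma trunc_lt_iff {d : ℕ} {u : Euc d → EReal} {y : Euc d} (h : u y < ⊤) {N a : ℝ} :
    trunc u N y < a ↔ u y < a ∧ -N < a := by
  rw [← EReal.coe_lt_coe_iff, coe_trunc h, max_lt_iff, EReal.coe_lt_coe_iff]

lemma trunc_usc {d : ℕ} {u : Euc d → EReal} {O : Set (Euc d)} (hu : SbhOn u O) (N : ℝ) :
    UpperSemicontinuousOn (trunc u N) O := by
  intro y hy a ha
  obtain ⟨h1, h2⟩ := (trunc_lt_iff (hu.2.1 y hy)).1 ha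
  filter_upwards [hu.1 y hy a h1, self_mem_nhdsWithin] with z hz hzO
  exact (trunc_lt_iff (hu.2.1 z hzO)).2 ⟨hz, h2⟩

lemma integrable_sphere_continuous {d : ℕ} (f : C(sphere (0 : Euc d) 1, ℝ)) :
    Integrable f (sphMeas d) :=
  f.continuous.integrable_of_hasCompactSupport (HasCompactSupport.of_compactSpace _)

/-- Comparison of a truncated subharmonic function with continuous boundary data. -/
lemma trunc_le_of_continuous {d : ℕ} (hd : 0 < d) {u : Euc d → EReal} {O : Set (Euc d)}
    (hu : SbhOn u O) (N : ℝ) {x : Euc d} {r : ℝ} (hr : 0 < r) (hb : closedBall x r ⊆ O)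
    (f : C(sphere (0 : Euc d) 1, ℝ)) (hf : ∀ ζ : sphere (0 : Euc d) 1, trunc u N (x + r • (ζ : Euc d)) ≤ f ζ) :
    sphMass d * trunc u N x ≤ ∫ ζ, f ζ ∂(sphMeas d) := by
  have hm := sphMass_pos hd
  refine le_of_forall_pos_le_add fun ε hε => ?_
  set e := ε / (2 * sphMass d) with he
  have he0 : 0 < e := by positivity
  obtain ⟨p, hp⟩ := exists_polyEval_near x hr f he0
  obtain ⟨H, hH, hHs⟩ := exists_harmonic_polynomial hd x hr (p + MvPolynomial.C e)
  have hpe : ∀ y, polyEval (p + MvPolynomial.C e) y = polyEval p y + e := by simp [polyEval]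
  have hpar : ∀ y ∈ sphere x r, ∃ ζ : sphere (0 : Euc d) 1, y = x + r • (ζ : Euc d) := by
    intro y hy
    refine ⟨⟨r⁻¹ • (y - x), ?_⟩, ?_⟩
    · rw [mem_sphere_zero_iff_norm, norm_smul, ← dist_eq_norm, mem_sphere.1 hy, norm_inv,
        Real.norm_of_nonneg hr.le, inv_mul_cancel₀ hr.ne']
    · rw [smul_smul, mul_inv_cancel₀ hr.ne', one_smul, add_sub_cancel]
  have hbd : ∀ y ∈ sphere x r, trunc u N y ≤ polyEval H y := by
    intro y hy
    rw [hHs y hy, hpe]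
    obtain ⟨ζ, rfl⟩ := hpar y hy
    have := (abs_lt.1 (hp ζ)).1
    linarith [hf ζ]
  have hxb : x ∈ closedBall x r := mem_closedBall_self hr.le
  have htop : ∀ y ∈ closedBall x r, u y < ⊤ := fun y hy => hu.2.1 y (hb hy)
  have h1 : u x ≤ polyEval H x := by
    refine hu.2.2 x r hr hb _ (polyEval_contDiff (n := 0) H).continuous.continuousOn
      (harmOn_polyEval hd hH _) (fun y hy => ?_) x hxb
    exact (le_trunc (htop y (sphere_subset_closedBall hy)) N).trans
      (EReal.coe_le_coe_iff.2 (hbd y hy))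
  have h2 : -N ≤ polyEval H x := by
    have e1 : ∀ y, polyEval (MvPolynomial.C (-N) - H) y = -N - polyEval H y := by simp [polyEval]
    have := polyEval_nonpos_of_sphere hd (p := MvPolynomial.C (-N) - H) (x := x)
      (by rw [map_sub, hH, sub_zero, polyLap_apply]; simp) hr (fun y hy => by
        rw [e1]
        linarith [neg_le_trunc (htop y (sphere_subset_closedBall hy)) N, hbd y hy]) x hxb
    rw [e1] at this
    linarith
  have h3 : trunc u N x ≤ polyEval H x := by
    rw [← EReal.coe_le_coe_iff, coe_trunc (htop x hxb)]
    exact max_le h1 (EReal.coe_le_coe_iff.2 h2)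
  have hHc : Continuous fun ζ : sphere (0 : Euc d) 1 => polyEval H (x + r • (ζ : Euc d)) :=
    (polyEval_contDiff (n := 0) H).continuous.comp (by fun_prop)
  have hHi : Integrable (fun ζ : sphere (0 : Euc d) 1 => polyEval H (x + r • (ζ : Euc d)))
      (sphMeas d) := hHc.integrable_of_hasCompactSupport (HasCompactSupport.of_compactSpace _)
  have hle : ∀ ζ : sphere (0 : Euc d) 1, polyEval H (x + r • (ζ : Euc d)) ≤ f ζ + 2 * e := by
    intro ζ
    have h4 := hHs (x + r • (ζ : Euc d)) (dist_add_smul_sphere x ζ hr.le)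
    rw [h4, hpe]
    linarith [(abs_lt.1 (hp ζ)).2]
  calc sphMass d * trunc u N x ≤ sphMass d * polyEval H x := by gcongr
    _ = ∫ ζ : sphere (0 : Euc d) 1, polyEval H (x + r • (ζ : Euc d)) ∂(sphMeas d) :=
      (sphInt_polyEval hd hH x hr).symm
    _ ≤ ∫ ζ, (f ζ + 2 * e) ∂(sphMeas d) :=
      integral_mono hHi ((integrable_sphere_continuous f).add (integrable_const _)) hle
    _ = ∫ ζ, f ζ ∂(sphMeas d) + ε := by
      rw [integral_add (integrable_sphere_continuous f) (integrable_const _)]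
      simp only [integral_const, smul_eq_mul]
      have : (sphMeas d).real univ * (2 * e) = ε := by
        change sphMass d * (2 * e) = ε
        rw [he]; field_simp
      rw [this]

/-- Spherical sub-mean value inequality for truncated subharmonic functions. -/
theorem trunc_le_sphInt {d : ℕ} (hd : 0 < d) {u : Euc d → EReal} {O : Set (Euc d)}
    (hu : SbhOn u O) (N : ℝ) {x : Euc d} {r : ℝ} (hr : 0 < r) (hb : closedBall x r ⊆ O) :
    sphMass d * trunc u N x ≤ sphInt (trunc u N) x r := by
  have hmem : ∀ ζ : sphere (0 : Euc d) 1, x + r • (ζ : Euc d) ∈ O := fun ζ =>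
    hb (dist_add_smul_sphere x ζ hr.le).le
  set v : sphere (0 : Euc d) 1 → ℝ := fun ζ => trunc u N (x + r • (ζ : Euc d)) with hv
  have husc : UpperSemicontinuous v := by
    rw [← upperSemicontinuousOn_univ_iff]
    exact (trunc_usc hu N).comp (f := trunc u N)
      (g := fun ζ : sphere (0 : Euc d) 1 => x + r • (ζ : Euc d)) (by fun_prop) fun ζ _ => hmem ζ
  have hlow : ∀ ζ, -N ≤ v ζ := fun ζ => neg_le_trunc (hu.2.1 _ (hmem ζ)) N
  obtain ⟨M, hM⟩ : ∃ M, ∀ ζ, v ζ ≤ M := by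
    obtain ⟨M, hM⟩ := (husc.upperSemicontinuousOn univ).bddAbove_of_isCompact isCompact_univ
    exact ⟨M, fun ζ => hM ⟨ζ, mem_univ _, rfl⟩⟩
  obtain ⟨f, hfv, hfM, hft⟩ := exists_continuous_tendsto_of_usc husc hM
  refine ge_of_tendsto' (tendsto_integral_of_dominated_convergence (fun _ => max |M| |N|)
    (fun n => (f n).continuous.aestronglyMeasurable) (integrable_const _)
    (fun n => Eventually.of_forall fun ζ => ?_) (Eventually.of_forall hft))
    fun n => trunc_le_of_continuous hd hu N hr hb (f n) (hfv n)
  rw [Real.norm_eq_abs, abs_le]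
  have h1 := hfM n ζ
  have h2 := (hlow ζ).trans (hfv n ζ)
  have h3 := le_abs_self M
  have h4 := le_abs_self N
  have h5 := le_max_left |M| |N|
  have h6 := le_max_right |M| |N|
  constructor <;> linarith

lemma euc_nontrivial {d : ℕ} (hd : 0 < d) : Nontrivial (Euc d) := by
  have : Nonempty (Fin d) := ⟨⟨0, hd⟩⟩
  infer_instance

lemma kap_measurable (d : ℕ) : Measurable (kap d) := by
  unfold kap
  split_ifs
  · exact measurable_id
  · exact Real.measurable_log
  · exact (measurable_id.pow_const _).neg

lemma kap_norm_measurable (d : ℕ) : Measurable fun z : Euc d => kap d ‖z‖ :=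
  (kap_measurable d).comp measurable_norm

/-- The fundamental kernel is locally integrable. -/
lemma kap_norm_integrableOn {d : ℕ} (hd : 0 < d) (R : ℝ) :
    IntegrableOn (fun z : Euc d => kap d ‖z‖) (ball 0 R) := by
  have := euc_nontrivial hd
  rw [integrableOn_fun_norm_addHaar, finrank_euclideanSpace_fin]
  have key : ∃ g : ℝ → ℝ, Continuous g ∧ ∀ y ∈ Ioo 0 R, y ^ (d - 1) • kap d y = g y := by
    unfold kap
    split_ifs with h1 h2
    · subst h1
      exact ⟨fun y => y, continuous_id, fun y _ => by simp⟩
    · subst h2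
      exact ⟨fun y => y * Real.log y, Real.continuous_mul_log, fun y _ => by simp⟩
    · refine ⟨fun y => -y, continuous_neg, fun y hy => ?_⟩
      rw [smul_eq_mul, mul_neg, ← Real.rpow_natCast, ← Real.rpow_add hy.1, Nat.cast_sub hd]
      norm_num
  obtain ⟨g, hg, he⟩ := key
  rw [integrableOn_congr_fun he measurableSet_Ioo]
  exact (hg.continuousOn.integrableOn_Icc).mono_set Ioo_subset_Icc_self

/-- The kernel truncated to a ball. -/
def kapBall (d : ℕ) (R : ℝ) : Euc d → ℝ := (ball 0 R).indicator fun z => kap d ‖z‖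

lemma kapBall_integrable {d : ℕ} (hd : 0 < d) (R : ℝ) : Integrable (kapBall d R) :=
  (kap_norm_integrableOn hd R).integrable_indicator measurableSet_ball

lemma kapBall_eq {d : ℕ} {R : ℝ} {z : Euc d} (h : ‖z‖ < R) : kapBall d R z = kap d ‖z‖ :=
  indicator_of_mem (by simpa using h) _

/-- The difference between the spherical average of the kernel and the kernel itself. -/
def newt (d : ℕ) (r : ℝ) (z : Euc d) : ℝ := kap d (max ‖z‖ r) - kap d ‖z‖

lemma newt_nonneg {d : ℕ} (hd : 0 < d) (r : ℝ) {z : Euc d} (hz : z ≠ 0) : 0 ≤ newt d r z :=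
  sub_nonneg.2 <| (kap_strictMonoOn hd).monotoneOn (norm_pos_iff.2 hz)
    (lt_max_of_lt_left (norm_pos_iff.2 hz)) (le_max_left _ _)

lemma newt_pos {d : ℕ} (hd : 0 < d) {r : ℝ} {z : Euc d} (hz : z ≠ 0) (hzr : ‖z‖ < r) :
    0 < newt d r z :=
  sub_pos.2 <| kap_strictMonoOn hd (norm_pos_iff.2 hz)
    (lt_max_of_lt_left (norm_pos_iff.2 hz)) (lt_max_of_lt_right hzr)

lemma newt_of_le {d : ℕ} {r : ℝ} {z : Euc d} (hzr : r ≤ ‖z‖) : newt d r z = 0 := by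
  simp [newt, max_eq_left hzr]

lemma newt_eq_indicator {d : ℕ} (r : ℝ) :
    newt d r = (ball 0 r).indicator fun z => kap d r - kap d ‖z‖ := by
  ext z
  by_cases h : ‖z‖ < r
  · rw [indicator_of_mem (by simpa using h), newt, max_eq_right h.le]
  · rw [indicator_of_notMem (by simpa using h), newt_of_le (not_lt.1 h)]

lemma newt_integrable {d : ℕ} (hd : 0 < d) (r : ℝ) : Integrable (newt d r) := by
  rw [newt_eq_indicator]
  refine IntegrableOn.integrable_indicator ?_ measurableSet_ball
  exact Integrable.sub (integrableOn_const measure_ball_lt_top.ne) (kap_norm_integrableOn hd r)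

lemma newt_integral_pos {d : ℕ} (hd : 0 < d) {r : ℝ} (hr : 0 < r) : 0 < ∫ z, newt d r z := by
  have := euc_nontrivial hd
  rw [integral_pos_iff_support_of_nonneg_ae _ (newt_integrable hd r)]
  · have h0 : volume (ball (0 : Euc d) r \ {0}) = volume (ball (0 : Euc d) r) :=
      measure_sdiff_null (measure_singleton 0)
    refine lt_of_lt_of_le ((measure_ball_pos volume (0 : Euc d) hr).trans_eq h0.symm)
      (measure_mono fun z hz => (newt_pos hd hz.2 (by simpa using hz.1)).ne')
  · filter_upwards [compl_mem_ae_iff.2 (measure_singleton (0 : Euc d))] with z hz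
    exact newt_nonneg hd r hz

/-- Newton's theorem: the spherical average of the kernel. -/
lemma integral_sphere_kap {d : ℕ} (hd : 0 < d) {r : ℝ} (hr : 0 < r) {z : Euc d} (hz : z ≠ 0)
    (hzr : ‖z‖ ≠ r) :
    ∫ ζ : sphere (0 : Euc d) 1, kap d ‖z - r • (ζ : Euc d)‖ ∂(sphMeas d)
      = sphMass d * kap d (max ‖z‖ r) := by
  have hz0 : 0 < ‖z‖ := norm_pos_iff.2 hz
  rcases hzr.lt_or_gt with h | h
  · have h1 := sphInt_kap hd (x := 0) (c := (r / ‖z‖) • z) hz0 (by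
      rw [dist_zero_left, norm_smul, norm_div, norm_norm, div_mul_cancel₀ _ hz0.ne',
        Real.norm_of_nonneg hr.le]
      exact h)
    rw [dist_zero_left, norm_smul, norm_div, norm_norm, div_mul_cancel₀ _ hz0.ne',
      Real.norm_of_nonneg hr.le] at h1
    rw [max_eq_right h.le, ← h1, sphInt]
    refine integral_congr_ae (Eventually.of_forall fun ζ => ?_)
    have hζ : ‖(ζ : Euc d)‖ = 1 := norm_eq_of_mem_sphere ζ
    simp only [zero_add, dist_eq_norm]
    congr 1
    rw [← sq_eq_sq₀ (norm_nonneg _) (norm_nonneg _), @norm_sub_sq_real, @norm_sub_sq_real]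
    simp only [norm_smul, inner_smul_left, inner_smul_right, norm_div, norm_norm, hζ,
      Real.norm_of_nonneg hr.le, div_mul_cancel₀ _ hz0.ne', real_inner_comm]
    simp only [RCLike.conj_to_real]
    field_simp
  · have h1 := sphInt_kap hd (x := 0) (c := z) hr (by rwa [dist_zero_left])
    rw [dist_zero_left] at h1
    rw [max_eq_left h.le, ← h1, sphInt]
    simp only [zero_add, dist_comm _ z, dist_eq_norm]

lemma integrable_sub_comp {d : ℕ} {X : Type*} [MeasurableSpace X] (σ : Measure X)
    [IsFiniteMeasure σ] {g : X → Euc d} (hg : Measurable g) {f : Euc d → ℝ} (hfm : Measurable f)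
    (hf : Integrable f) :
    Integrable (fun p : Euc d × X => f (p.1 - g p.2)) ((volume : Measure (Euc d)).prod σ) := by
  have hm : Measurable fun p : Euc d × X => f (p.1 - g p.2) :=
    hfm.comp (measurable_fst.sub (hg.comp measurable_snd))
  rw [integrable_prod_iff' hm.aestronglyMeasurable]
  refine ⟨Eventually.of_forall fun y => hf.comp_sub_right (g y), ?_⟩
  have : ∀ y, ∫ x, ‖f (x - g y)‖ = ∫ x, ‖f x‖ := fun y =>
    integral_sub_right_eq_self (fun x => ‖f x‖) (g y)
  simp only [this]
  exact integrable_const _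

lemma kapBall_measurable (d : ℕ) (R : ℝ) : Measurable (kapBall d R) :=
  (kap_norm_measurable d).indicator measurableSet_ball

/-- Integrability of the kernel against a bounded, boundedly supported density. -/
lemma integrable_mul_kap {d : ℕ} (hd : 0 < d) {X : Type*} [MeasurableSpace X] (σ : Measure X)
    [IsFiniteMeasure σ] {g : X → Euc d} (hg : Measurable g) {w : Euc d × X → ℝ} (hw : Measurable w)
    {M R : ℝ} (hM : ∀ p, |w p| ≤ M) (hR : ∀ᵐ y ∂σ, ∀ x, w (x, y) ≠ 0 → ‖x - g y‖ < R) :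
    Integrable (fun p : Euc d × X => w p * kap d ‖p.1 - g p.2‖)
      ((volume : Measure (Euc d)).prod σ) := by
  have h1 := ((integrable_sub_comp σ hg (kapBall_measurable d R) (kapBall_integrable hd R)).norm).const_mul M
  have hm := kap_norm_measurable d
  refine h1.mono' ?_ ?_
  · exact (hw.mul (hm.comp (measurable_fst.sub (hg.comp measurable_snd)))).aestronglyMeasurable
  · filter_upwards [Measure.quasiMeasurePreserving_snd.ae hR] with p hp
    rw [norm_mul, Real.norm_eq_abs (w p)]
    by_cases h0 : w p = 0
    · rw [h0, abs_zero, zero_mul]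
      exact mul_nonneg ((abs_nonneg _).trans (hM p)) (norm_nonneg _)
    · rw [kapBall_eq (hp p.1 h0)]
      exact mul_le_mul_of_nonneg_right (hM p) (norm_nonneg _)

lemma sphInt_measurable {d : ℕ} {v : Euc d → ℝ} (hv : Measurable v) (r : ℝ) :
    Measurable fun x => sphInt v x r := by
  have : StronglyMeasurable (Function.uncurry fun (x : Euc d) (ζ : sphere (0 : Euc d) 1) =>
      v (x + r • (ζ : Euc d))) := by
    refine Measurable.stronglyMeasurable ?_
    exact hv.comp (by fun_prop)
  exact this.integral_prod_right.measurable

/-- Spherical averaging of a density amounts to spherical averaging of the kernel. -/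
theorem integral_sphInt_sub_mul_kap {d : ℕ} (hd : 0 < d) {v : Euc d → ℝ} (hv : Measurable v)
    {M R : ℝ} (hM : ∀ x, |v x| ≤ M) (hR : ∀ x, v x ≠ 0 → ‖x‖ < R) {r : ℝ} (hr : 0 < r) (y : Euc d) :
    ∫ x, (sphInt v x r - sphMass d * v x) * kap d ‖x - y‖
      = sphMass d * ∫ x, v x * newt d r (x - y) := by
  have := euc_nontrivial hd
  have hF : Integrable (fun p : Euc d × sphere (0 : Euc d) 1 =>
      v p.1 * kap d ‖p.1 - (y + r • (p.2 : Euc d))‖) ((volume : Measure (Euc d)).prod (sphMeas d)) := by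
    refine integrable_mul_kap hd (sphMeas d) (g := fun ζ : sphere (0 : Euc d) 1 => y + r • (ζ : Euc d))
      (w := fun p => v p.1) (R := R + (‖y‖ + r)) (by fun_prop) (by fun_prop) (fun p => hM _)
      (Eventually.of_forall fun ζ x hx => ?_)
    calc ‖x - (y + r • (ζ : Euc d))‖ ≤ ‖x‖ + (‖y‖ + ‖r • (ζ : Euc d)‖) :=
          (norm_sub_le _ _).trans (by gcongr; exact norm_add_le _ _)
      _ < R + (‖y‖ + r) := by
          rw [norm_smul_sphere ζ hr.le]; linarith [hR x hx]
  have hF' : Integrable (fun p : Euc d × sphere (0 : Euc d) 1 =>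
      v (p.1 + r • (p.2 : Euc d)) * kap d ‖p.1 - y‖)
      ((volume : Measure (Euc d)).prod (sphMeas d)) := by
    refine integrable_mul_kap hd (sphMeas d) (g := fun _ => y)
      (w := fun p => v (p.1 + r • (p.2 : Euc d))) (R := R + r + ‖y‖) (by fun_prop) (by fun_prop)
      (fun p => hM _) (Eventually.of_forall fun ζ x hx => ?_)
    have h1 := hR _ hx
    have h2 : ‖x‖ ≤ ‖x + r • (ζ : Euc d)‖ + ‖r • (ζ : Euc d)‖ := by
      simpa using norm_sub_le (x + r • (ζ : Euc d)) (r • (ζ : Euc d))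
    rw [norm_smul_sphere ζ hr.le] at h2
    linarith [norm_sub_le x y]
  have hvk : Integrable (fun x => v x * kap d ‖x - y‖) := by
    have := (integrable_mul_kap hd (Measure.dirac ()) (g := fun _ => y) (w := fun p => v p.1)
      (R := R + ‖y‖) (by fun_prop) (by fun_prop) (fun p => hM _)
      (Eventually.of_forall fun _ x hx => (norm_sub_le x y).trans_lt (by linarith [hR x hx])))
    simpa using this.integral_prod_left
  have e1 : ∀ x, ∫ ζ : sphere (0 : Euc d) 1, v (x + r • (ζ : Euc d)) * kap d ‖x - y‖ ∂(sphMeas d)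
      = sphInt v x r * kap d ‖x - y‖ := fun x => integral_mul_const _ _
  have e2 : ∀ᵐ x, ∫ ζ : sphere (0 : Euc d) 1, v x * kap d ‖x - (y + r • (ζ : Euc d))‖ ∂(sphMeas d)
      = sphMass d * (v x * kap d (max ‖x - y‖ r)) := by
    filter_upwards [compl_mem_ae_iff.2 (measure_singleton y),
      compl_mem_ae_iff.2 (Measure.addHaar_sphere (volume : Measure (Euc d)) y r)] with x h1 h2
    rw [integral_const_mul]
    simp only [← sub_sub]
    rw [integral_sphere_kap hd hr (sub_ne_zero.2 h1) (by simpa [dist_eq_norm] using h2)]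
    ring
  have i1 : Integrable fun x => sphInt v x r * kap d ‖x - y‖ := by
    simpa only [e1] using hF'.integral_prod_left
  have i2 : Integrable fun x => sphMass d * (v x * kap d (max ‖x - y‖ r)) :=
    hF.integral_prod_left.congr e2
  have key : ∫ x, sphInt v x r * kap d ‖x - y‖ = ∫ x, sphMass d * (v x * kap d (max ‖x - y‖ r)) := by
    rw [← integral_congr_ae e2]
    simp only [← e1]
    rw [integral_integral_swap (f := fun x (ζ : sphere (0 : Euc d) 1) =>
        v (x + r • (ζ : Euc d)) * kap d ‖x - y‖) hF',
      integral_integral_swap (f := fun x (ζ : sphere (0 : Euc d) 1) =>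
        v x * kap d ‖x - (y + r • (ζ : Euc d))‖) hF]
    congr 1
    ext ζ
    rw [← integral_sub_right_eq_self (μ := volume)
      (fun x => v (x + r • (ζ : Euc d)) * kap d ‖x - y‖) (r • (ζ : Euc d))]
    simp only [sub_add_cancel, sub_sub, add_comm y]
  have e3 : ∀ x, (sphInt v x r - sphMass d * v x) * kap d ‖x - y‖
      = sphInt v x r * kap d ‖x - y‖ - sphMass d * (v x * kap d ‖x - y‖) := fun x => by ring
  simp only [e3]
  rw [integral_sub i1 (hvk.const_mul _), key, ← integral_sub i2 (hvk.const_mul _),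
    ← integral_const_mul]
  congr 1
  ext x
  simp only [newt]
  ring

/-- The real potential agrees almost everywhere with the extended-real one. -/
theorem eInt_Kker_ae {d : ℕ} (hd : 0 < d) {μ : Measure (Euc d)} [IsFiniteMeasure μ] {L : Set (Euc d)}
    (hL : IsCompact L) (hμ : μ Lᶜ = 0) :
    ∀ᵐ x, Integrable (fun y => kap d ‖x - y‖) μ ∧
      eInt μ (fun y => Kker d y x) = ((∫ y, kap d ‖x - y‖ ∂μ : ℝ) : EReal) := by
  have := euc_nontrivial hd
  obtain ⟨B, hB⟩ := hL.isBounded.exists_norm_le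
  have h1 : ∀ n : ℕ, ∀ᵐ x, Integrable
      (fun y => (ball (0 : Euc d) n).indicator (fun _ => (1 : ℝ)) x * kap d ‖x - y‖) μ := by
    intro n
    have := integrable_mul_kap hd μ (g := fun y => y)
      (w := fun p => (ball (0 : Euc d) n).indicator (fun _ => (1 : ℝ)) p.1) (M := 1) (R := n + B)
      measurable_id ((measurable_const.indicator measurableSet_ball).comp measurable_fst)
      (fun p => ?_) ?_
    · exact this.prod_right_ae
    · by_cases h : p.1 ∈ ball (0 : Euc d) n <;> simp [indicator, h]
    · filter_upwards [ae_mem_of_compl_null hμ] with y hy x hx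
      have hx' : x ∈ ball (0 : Euc d) n := by
        by_contra h
        exact hx (indicator_of_notMem h _)
      rw [mem_ball_zero_iff] at hx'
      exact (norm_sub_le x y).trans_lt (by linarith [hB y hy])
  have h2 : ∀ᵐ x, μ {x} = 0 := by
    have hc := Measure.countable_meas_level_set_pos (μ := μ) (g := (id : Euc d → Euc d)) measurable_id
    filter_upwards [compl_mem_ae_iff.2 (hc.measure_zero volume)] with x hx
    simpa using hx
  filter_upwards [ae_all_iff.2 h1, h2] with x hx hx0
  have hi : Integrable (fun y => kap d ‖x - y‖) μ := by
    obtain ⟨n, hn⟩ := exists_nat_gt ‖x‖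
    have h := hx n
    rw [indicator_of_mem (by simpa using hn)] at h
    simpa using h
  refine ⟨hi, ?_⟩
  rw [← eInt_coe hi]
  refine eInt_congr_ae ?_
  filter_upwards [compl_mem_ae_iff.2 hx0] with y hy
  rw [Kker_of_ne hy, dist_comm, dist_eq_norm]

/-- Fubini's theorem for potentials. -/
theorem integral_integral_mul_kap {d : ℕ} (hd : 0 < d) {μ : Measure (Euc d)} [IsFiniteMeasure μ]
    {L : Set (Euc d)} (hL : IsCompact L) (hμ : μ Lᶜ = 0) {V : Euc d → ℝ} (hV : Measurable V)
    {M R : ℝ} (hM : ∀ x, |V x| ≤ M) (hR : ∀ x, V x ≠ 0 → ‖x‖ < R) :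
    Integrable (fun x => V x * ∫ y, kap d ‖x - y‖ ∂μ) ∧
    Integrable (fun y => ∫ x, V x * kap d ‖x - y‖) μ ∧
    ∫ y, (∫ x, V x * kap d ‖x - y‖) ∂μ = ∫ x, V x * ∫ y, kap d ‖x - y‖ ∂μ := by
  obtain ⟨B, hB⟩ := hL.isBounded.exists_norm_le
  have h := integrable_mul_kap hd μ (g := fun y => y) (w := fun p => V p.1) (R := R + B)
    measurable_id (by fun_prop) (fun p => hM p.1) (by
      filter_upwards [ae_mem_of_compl_null hμ] with y hy x hx
      exact (norm_sub_le x y).trans_lt (by linarith [hB y hy, hR x hx]))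
  have e : ∀ x, ∫ y, V x * kap d ‖x - y‖ ∂μ = V x * ∫ y, kap d ‖x - y‖ ∂μ :=
    fun x => integral_const_mul _ _
  refine ⟨?_, h.integral_prod_right, ?_⟩
  · simpa only [e] using h.integral_prod_left
  · simp only [← e]
    exact (integral_integral_swap (f := fun x y => V x * kap d ‖x - y‖) h).symm

lemma integrable_mul_newt {d : ℕ} (hd : 0 < d) {v : Euc d → ℝ} (hv : Measurable v) {M : ℝ}
    (hM : ∀ x, |v x| ≤ M) (r : ℝ) (y : Euc d) : Integrable fun x => v x * newt d r (x - y) :=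
  ((newt_integrable hd r).comp_sub_right y).bdd_mul hv.aestronglyMeasurable
    (Eventually.of_forall hM)

lemma integral_mul_newt_le {d : ℕ} (hd : 0 < d) {v : Euc d → ℝ} (hv : Measurable v) {M : ℝ}
    (hM : ∀ x, |v x| ≤ M) {r : ℝ} {y : Euc d} {a : ℝ} (ha : ∀ x, ‖x - y‖ < r → v x ≤ a) :
    ∫ x, v x * newt d r (x - y) ≤ a * ∫ z, newt d r z := by
  have := euc_nontrivial hd
  rw [← integral_sub_right_eq_self (μ := volume) (newt d r) y, ← integral_const_mul]
  refine integral_mono_ae (integrable_mul_newt hd hv hM r y)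
    (((newt_integrable hd r).comp_sub_right y).const_mul a) ?_
  filter_upwards [compl_mem_ae_iff.2 (measure_singleton y)] with x hx
  rcases lt_or_ge ‖x - y‖ r with h | h
  · exact mul_le_mul_of_nonneg_right (ha x h) (newt_nonneg hd r (sub_ne_zero.2 hx))
  · simp [newt_of_le h]

lemma le_integral_mul_newt {d : ℕ} (hd : 0 < d) {v : Euc d → ℝ} (hv : Measurable v) {M : ℝ}
    (hM : ∀ x, |v x| ≤ M) {r : ℝ} {y : Euc d}
    (hs : ∀ s, 0 < s → s < r → sphMass d * v y ≤ sphInt v y s) :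
    v y * ∫ z, newt d r z ≤ ∫ x, v x * newt d r (x - y) := by
  have hf : Integrable fun z => v (z + y) * newt d r z := by
    simpa using (integrable_mul_newt hd hv hM r y).comp_add_right y
  have hg : Integrable fun z => v y * newt d r z := (newt_integrable hd r).const_mul _
  have e := integral_sub_right_eq_self (μ := volume) (fun z => v (z + y) * newt d r z) y
  simp only [sub_add_cancel] at e
  rw [e, ← integral_const_mul, integral_polar hd hf, integral_polar hd hg]
  refine setIntegral_mono_on (integrableOn_sphInt hg) (integrableOn_sphInt hf) measurableSet_Ioi
    fun s hs0 => ?_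
  have hs0' : 0 < s := hs0
  refine mul_le_mul_of_nonneg_left ?_ (pow_nonneg hs0'.le _)
  have hn : ∀ ζ : sphere (0 : Euc d) 1, newt d r (s • (ζ : Euc d)) = kap d (max s r) - kap d s := by
    intro ζ
    rw [newt, norm_smul_sphere ζ hs0'.le]
  simp only [sphInt, zero_add, hn, integral_mul_const, integral_const, smul_eq_mul]
  rcases lt_or_ge s r with h | h
  · refine mul_le_mul_of_nonneg_right ?_ ?_
    · simpa only [sphInt, sphMass, add_comm] using hs s hs0' h
    · exact sub_nonneg.2 ((kap_strictMonoOn hd).monotoneOn hs0 (lt_max_of_lt_left hs0')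
        (le_max_left _ _))
  · simp [max_eq_left h]

/-- A comparison of potentials yields a comparison of integrals of functions satisfying the
spherical sub-mean value inequality. -/
theorem integral_le_of_potential_le {d : ℕ} (hd : 0 < d) {δ ω : Measure (Euc d)} [IsFiniteMeasure δ]
    [IsFiniteMeasure ω] {Q O : Set (Euc d)} (hQ : IsCompact Q) (hδ : δ Qᶜ = 0)
    (hω : ω Qᶜ = 0) {v : Euc d → ℝ} (hv : Measurable v) {M R : ℝ} (hM : ∀ x, |v x| ≤ M)
    (hR : ∀ x, v x ≠ 0 → ‖x‖ < R) {ρ : ℝ} (hρ : 0 < ρ)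
    (hs : ∀ y ∈ Q, ∀ s, 0 < s → s < ρ → sphMass d * v y ≤ sphInt v y s)
    (husc : ∀ y ∈ Q, UpperSemicontinuousAt v y)
    (hvO : ∀ x ∉ O, ∀ s, 0 < s → s < ρ → sphInt v x s - sphMass d * v x = 0)
    (hle : ∀ᵐ x, x ∈ O → ∫ y, kap d ‖x - y‖ ∂δ ≤ ∫ y, kap d ‖x - y‖ ∂ω)
    (heq : ∀ᵐ x, x ∈ O \ Q → ∫ y, kap d ‖x - y‖ ∂δ = ∫ y, kap d ‖x - y‖ ∂ω) :
    ∫ y, v y ∂δ ≤ ∫ y, v y ∂ω := by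
  have hm := sphMass_pos hd
  have hQδ := ae_mem_of_compl_null hδ
  have hQω := ae_mem_of_compl_null hω
  set c : ℝ → ℝ := fun r => ∫ z, newt d r z with hc
  have hcpos : ∀ r, 0 < r → 0 < c r := fun r hr => newt_integral_pos hd hr
  set m : ℝ → Euc d → ℝ := fun r y => (∫ x, v x * newt d r (x - y)) / c r with hmdef
  have hlow : ∀ r, 0 < r → r < ρ → ∀ y ∈ Q, v y ≤ m r y := fun r hr hrρ y hy =>
    (le_div_iff₀ (hcpos r hr)).2
      (le_integral_mul_newt hd hv hM fun s h0 h1 => hs y hy s h0 (h1.trans hrρ))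
  have hup : ∀ r, 0 < r → ∀ y a, (∀ x, ‖x - y‖ < r → v x ≤ a) → m r y ≤ a := fun r hr y a ha =>
    (div_le_iff₀ (hcpos r hr)).2 (integral_mul_newt_le hd hv hM ha)
  have hint : ∀ r, 0 < r → ∀ μ : Measure (Euc d), IsFiniteMeasure μ → μ Qᶜ = 0 →
      Integrable (fun x => (sphInt v x r - sphMass d * v x) * ∫ y, kap d ‖x - y‖ ∂μ) ∧
      Integrable (m r) μ ∧
      ∫ y, m r y ∂μ = (sphMass d * c r)⁻¹ *
        ∫ x, (sphInt v x r - sphMass d * v x) * ∫ y, kap d ‖x - y‖ ∂μ := by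
    intro r hr μ _ hμ
    obtain ⟨h1, h2, h3⟩ := integral_integral_mul_kap hd hQ hμ
      (V := fun x => sphInt v x r - sphMass d * v x)
      ((sphInt_measurable hv r).sub (hv.const_mul _)) (M := 2 * (sphMass d * M)) (R := R + r)
      (fun x => by
        have h4 : |sphInt v x r| ≤ sphMass d * M := by
          have := norm_integral_le_of_norm_le_const (μ := sphMeas d)
            (f := fun ζ : sphere (0 : Euc d) 1 => v (x + r • (ζ : Euc d))) (C := M)
            (Eventually.of_forall fun ζ => hM _)
          rwa [mul_comm] at this
        have h5 : |sphMass d * v x| ≤ sphMass d * M := by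
          rw [abs_mul, abs_of_pos hm]
          exact mul_le_mul_of_nonneg_left (hM x) hm.le
        linarith [abs_sub (sphInt v x r) (sphMass d * v x)])
      (fun x hx => by
        by_contra hcon
        refine hx ?_
        have h6 : ∀ z, ‖z - x‖ ≤ r → v z = 0 := by
          intro z hz
          by_contra hz0
          have := hR z hz0
          have h7 := norm_sub_norm_le x z
          rw [norm_sub_rev] at h7
          linarith
        have h8 : ∀ ζ : sphere (0 : Euc d) 1, v (x + r • (ζ : Euc d)) = 0 := fun ζ => h6 _ (by
          rw [add_sub_cancel_left, norm_smul_sphere ζ hr.le])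
        simp [sphInt, h8, h6 x (by simpa using hr.le)])
    have h9 : ∀ y, m r y = (sphMass d * c r)⁻¹ *
        ∫ x, (sphInt v x r - sphMass d * v x) * kap d ‖x - y‖ := by
      intro y
      rw [integral_sphInt_sub_mul_kap hd hv hM hR hr y, hmdef]
      have := (hcpos r hr).ne'
      field_simp
    refine ⟨h1, ?_, ?_⟩
    · rw [funext h9]
      exact h2.const_mul _
    · simp only [h9]
      rw [integral_const_mul, h3]
  have hcmp : ∀ r, 0 < r → r < ρ → ∫ y, m r y ∂δ ≤ ∫ y, m r y ∂ω := by
    intro r hr hrρ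
    obtain ⟨h1, -, h2⟩ := hint r hr δ inferInstance hδ
    obtain ⟨h3, -, h4⟩ := hint r hr ω inferInstance hω
    rw [h2, h4]
    refine mul_le_mul_of_nonneg_left (integral_mono_ae h1 h3 ?_)
      (inv_nonneg.2 (mul_pos hm (hcpos r hr)).le)
    filter_upwards [hle, heq] with x hx1 hx2
    by_cases hxO : x ∈ O
    · by_cases hxQ : x ∈ Q
      · exact mul_le_mul_of_nonneg_left (hx1 hxO) (sub_nonneg.2 (hs x hxQ r hr hrρ))
      · exact (congrArg _ (hx2 ⟨hxO, hxQ⟩)).le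
    · simp only [hvO x hxO r hr hrρ, zero_mul, le_refl]
  have hvi : ∀ μ : Measure (Euc d), IsFiniteMeasure μ → Integrable v μ := fun μ _ =>
    (integrable_const M).mono' hv.aestronglyMeasurable (Eventually.of_forall hM)
  have hfin : ∀ r, 0 < r → r < ρ → ∫ y, v y ∂δ ≤ ∫ y, m r y ∂ω := fun r hr hrρ =>
    (integral_mono_ae (hvi δ inferInstance) (hint r hr δ inferInstance hδ).2.1
      (hQδ.mono fun y hy => hlow r hr hrρ y hy)).trans (hcmp r hr hrρ)
  set rr : ℕ → ℝ := fun n => ρ / ((n : ℝ) + 2) with hrr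
  have hr0 : ∀ n, 0 < rr n := fun n => by positivity
  have hr1 : ∀ n, rr n < ρ := fun n => by
    have : (0 : ℝ) ≤ n := n.cast_nonneg
    exact div_lt_self hρ (by linarith)
  have hrt : Tendsto rr atTop (𝓝 0) :=
    Tendsto.div_atTop tendsto_const_nhds
      (tendsto_atTop_add_const_right _ _ tendsto_natCast_atTop_atTop)
  refine ge_of_tendsto' (tendsto_integral_of_dominated_convergence (fun _ => M)
    (fun n => (hint (rr n) (hr0 n) ω inferInstance hω).2.1.aestronglyMeasurable) (integrable_const M)
    (fun n => ?_) ?_) fun n => hfin (rr n) (hr0 n) (hr1 n)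
  · filter_upwards [hQω] with y hy
    rw [Real.norm_eq_abs, abs_le]
    exact ⟨(abs_le.1 (hM y)).1.trans (hlow _ (hr0 n) (hr1 n) y hy),
      hup _ (hr0 n) y M fun x _ => (abs_le.1 (hM x)).2⟩
  · filter_upwards [hQω] with y hy
    refine tendsto_order.2 ⟨fun a ha => Eventually.of_forall fun n =>
      ha.trans_le (hlow _ (hr0 n) (hr1 n) y hy), fun a ha => ?_⟩
    obtain ⟨b, hb, hba⟩ := exists_between ha
    obtain ⟨η, hη, hball⟩ := Metric.eventually_nhds_iff.1 (husc y hy b hb)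
    filter_upwards [hrt.eventually_lt_const hη] with n hn
    refine (hup _ (hr0 n) y b fun x hx => (hball ?_).le).trans_lt hba
    rw [dist_eq_norm]
    exact hx.trans hn

lemma erealPos_eq_ofReal_trunc {d : ℕ} {u : Euc d → EReal} {y : Euc d} (h : u y < ⊤) {N : ℝ}
    (hN : 0 ≤ N) : erealPos (u y) = ENNReal.ofReal (trunc u N y) := by
  unfold trunc
  induction hu : u y with
  | bot => simp [erealPos, hN]
  | top => exact absurd hu h.ne
  | coe a =>
    rw [erealPos_coe, ← EReal.coe_strictMono.monotone.map_max, EReal.toReal_coe, ENNReal.ofReal_max,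
      ENNReal.ofReal_of_nonpos (p := -N) (by linarith), max_eq_left zero_le]

lemma trunc_antitone {d : ℕ} {u : Euc d → EReal} {y : Euc d} (h : u y < ⊤) :
    Antitone fun N => trunc u N y := by
  intro N N' hN
  simp only
  rw [← EReal.coe_le_coe_iff, coe_trunc h, coe_trunc h]
  exact max_le_max le_rfl (EReal.coe_le_coe_iff.2 (neg_le_neg hN))

lemma tendsto_ofReal_neg_trunc {d : ℕ} {u : Euc d → EReal} {y : Euc d} (h : u y < ⊤) :
    Tendsto (fun n : ℕ => ENNReal.ofReal (-trunc u n y)) atTop (𝓝 (erealPos (-u y))) := by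
  unfold trunc
  induction hu : u y with
  | bot =>
    have hn : ∀ n : ℕ, ENNReal.ofReal (-(max (⊥ : EReal) ((-(n : ℝ) : ℝ) : EReal)).toReal) = n := by
      intro n
      rw [max_eq_right bot_le, EReal.toReal_coe, neg_neg, ENNReal.ofReal_natCast]
    simp only [hn, erealPos, EReal.neg_bot, if_true]
    exact ENNReal.tendsto_nat_nhds_top
  | top => exact absurd hu h.ne
  | coe a =>
    rw [← EReal.coe_neg, erealPos_coe]
    refine tendsto_const_nhds.congr' ?_
    obtain ⟨n, hn⟩ := exists_nat_gt (-a)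
    filter_upwards [eventually_ge_atTop n] with m hm
    have : (n : ℝ) ≤ m := by exact_mod_cast hm
    rw [← EReal.coe_strictMono.monotone.map_max, EReal.toReal_coe, max_eq_left (by linarith)]

lemma UpperSemicontinuousOn.measurable_indicator {d : ℕ} {f : Euc d → ℝ} {C : Set (Euc d)}
    (hf : UpperSemicontinuousOn f C) (hC : MeasurableSet C) : Measurable (C.indicator f) := by
  refine measurable_of_restrict_of_restrict_compl hC ?_ ?_
  · have he : C.domRestrict (C.indicator f) = C.domRestrict f :=
      funext fun x => indicator_of_mem x.2 f
    rw [he]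
    exact (upperSemicontinuousOn_iff_restrict.2 hf).measurable
  · have he : Cᶜ.domRestrict (C.indicator f) = fun _ => 0 :=
      funext fun x => indicator_of_notMem x.2 f
    rw [he]
    exact measurable_const

lemma exists_abs_indicator_trunc_le {d : ℕ} {u : Euc d → EReal} {O C : Set (Euc d)}
    (hu : SbhOn u O) (hC : IsCompact C) (hCO : C ⊆ O) (n : ℕ) :
    ∃ M, ∀ y, |C.indicator (trunc u n) y| ≤ M := by
  obtain ⟨M, hM⟩ := ((trunc_usc hu n).mono hCO).bddAbove_of_isCompact hC
  refine ⟨max |M| n, fun y => ?_⟩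
  by_cases hy : y ∈ C
  · rw [indicator_of_mem hy, abs_le]
    have h1 : trunc u n y ≤ M := hM ⟨y, hy, rfl⟩
    have h2 := neg_le_trunc (hu.2.1 y (hCO hy)) n
    have h3 := le_abs_self M
    have h4 := le_max_left |M| (n : ℝ)
    have h5 := le_max_right |M| (n : ℝ)
    constructor <;> linarith
  · rw [indicator_of_notMem hy, abs_zero]
    exact (abs_nonneg M).trans (le_max_left _ _)

/-- Integrals of subharmonic functions are limits of integrals of their truncations. -/
theorem eInt_le_of_trunc {d : ℕ} {u : Euc d → EReal} {O C : Set (Euc d)} (hu : SbhOn u O)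
    (hC : IsCompact C) (hCO : C ⊆ O) {δ ω : Measure (Euc d)} [IsFiniteMeasure δ] [IsFiniteMeasure ω]
    (hδ : δ Cᶜ = 0) (hω : ω Cᶜ = 0)
    (hint : ∀ n : ℕ, ∫ y, C.indicator (trunc u n) y ∂δ ≤ ∫ y, C.indicator (trunc u n) y ∂ω) :
    eInt δ u ≤ eInt ω u := by
  have hlt : ∀ y ∈ C, u y < ⊤ := fun y hy => hu.2.1 y (hCO hy)
  have hmeas : ∀ n : ℕ, Measurable (C.indicator (trunc u n)) := fun n =>
    ((trunc_usc hu n).mono hCO).measurable_indicator hC.measurableSet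
  have hintg : ∀ (μ : Measure (Euc d)) [IsFiniteMeasure μ] (n : ℕ),
      Integrable (C.indicator (trunc u n)) μ := by
    intro μ _ n
    obtain ⟨M, hM⟩ := exists_abs_indicator_trunc_le hu hC hCO n
    exact (integrable_const M).mono' (hmeas n).aestronglyMeasurable (Eventually.of_forall hM)
  have hpos : ∀ (μ : Measure (Euc d)), μ Cᶜ = 0 → ∀ n : ℕ,
      ∫⁻ y, erealPos (u y) ∂μ = ∫⁻ y, ENNReal.ofReal (C.indicator (trunc u n) y) ∂μ := by
    intro μ hμ n
    refine lintegral_congr_ae ?_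
    filter_upwards [ae_mem_of_compl_null hμ] with y hy
    rw [indicator_of_mem hy, erealPos_eq_ofReal_trunc (hlt y hy) n.cast_nonneg]
  have hval : ∀ (μ : Measure (Euc d)) [IsFiniteMeasure μ], μ Cᶜ = 0 → ∀ n : ℕ,
      ((∫ y, C.indicator (trunc u n) y ∂μ : ℝ) : EReal)
        = ((∫⁻ y, erealPos (u y) ∂μ : ℝ≥0∞) : EReal)
          - ((∫⁻ y, ENNReal.ofReal (-C.indicator (trunc u n) y) ∂μ : ℝ≥0∞) : EReal) := by
    intro μ _ hμ n
    rw [← eInt_coe (hintg μ n), hpos μ hμ n]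
    simp only [eInt, ← EReal.coe_neg, erealPos_coe]
  have hlim : ∀ (μ : Measure (Euc d)) [IsFiniteMeasure μ], μ Cᶜ = 0 →
      Tendsto (fun n : ℕ => ((∫ y, C.indicator (trunc u n) y ∂μ : ℝ) : EReal)) atTop
        (𝓝 (eInt μ u)) := by
    intro μ _ hμ
    have h1 : Tendsto (fun n : ℕ => ∫⁻ y, ENNReal.ofReal (-C.indicator (trunc u n) y) ∂μ) atTop
        (𝓝 (∫⁻ y, erealPos (-u y) ∂μ)) := by
      refine lintegral_tendsto_of_tendsto_of_monotone
        (fun n => (hmeas n).neg.ennreal_ofReal.aemeasurable) ?_ ?_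
      · filter_upwards [ae_mem_of_compl_null hμ] with y hy
        intro n m hnm
        simp only [indicator_of_mem hy]
        exact ENNReal.ofReal_le_ofReal
          (neg_le_neg (trunc_antitone (hlt y hy) (Nat.cast_le.2 hnm)))
      · filter_upwards [ae_mem_of_compl_null hμ] with y hy
        simpa only [indicator_of_mem hy] using tendsto_ofReal_neg_trunc (hlt y hy)
    have h2 : ∫⁻ y, erealPos (u y) ∂μ ≠ ⊤ := by
      rw [hpos μ hμ 0]
      exact (hintg μ 0).lintegral_lt_top.ne
    have h3 := (EReal.continuousAt_add (p := (((∫⁻ y, erealPos (u y) ∂μ : ℝ≥0∞) : EReal),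
      -((∫⁻ y, erealPos (-u y) ∂μ : ℝ≥0∞) : EReal))) (Or.inl (by simpa using h2))
      (Or.inl (EReal.coe_ennreal_ne_bot _))).tendsto
    simp only [hval μ hμ]
    unfold eInt
    simp only [sub_eq_add_neg]
    exact h3.comp (tendsto_const_nhds.prodMk_nhds
      ((continuous_neg.tendsto _).comp ((continuous_coe_ennreal_ereal.tendsto _).comp h1)))
  exact le_of_tendsto_of_tendsto' (hlim δ hδ) (hlim ω hω) fun n => EReal.coe_le_coe_iff.2 (hint n)

/-- Comparison of potentials implies balayage. -/
theorem balayage_of_potential_le {d : ℕ} (hd : 0 < d) {O : Set (Euc d)} (hO : IsOpen O)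
    {δ ω : Measure (Euc d)} (hδ : MeasCompIn δ O) (hω : MeasCompIn ω O) {S : Set (Euc d)}
    (hS : IsCompact S) (hSO : S ⊆ O)
    (hle : ∀ x ∈ O, eInt δ (fun y => Kker d y x) ≤ eInt ω (fun y => Kker d y x))
    (heq : ∀ x ∈ O \ S, eInt δ (fun y => Kker d y x) = eInt ω (fun y => Kker d y x))
    {u : Euc d → EReal} (hu : SbhOn u O) : eInt δ u ≤ eInt ω u := by
  have : IsFiniteMeasure δ := ⟨hδ.2.2.2⟩
  have : IsFiniteMeasure ω := ⟨hω.2.2.2⟩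
  set Q := S ∪ (msupp δ ∪ msupp ω) with hQdef
  have hQ : IsCompact Q := hS.union (hδ.1.union hω.1)
  have hQO : Q ⊆ O := union_subset hSO (union_subset hδ.2.1 hω.2.1)
  have hδQ : δ Qᶜ = 0 := measure_mono_null (compl_subset_compl.2 fun y hy => Or.inr (Or.inl hy))
    hδ.2.2.1
  have hωQ : ω Qᶜ = 0 := measure_mono_null (compl_subset_compl.2 fun y hy => Or.inr (Or.inr hy))
    hω.2.2.1
  obtain ⟨ρ₀, hρ₀, hρO⟩ := hQ.exists_cthickening_subset_open hO hQO
  set ρ := ρ₀ / 2 with hρdef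
  have hρ : 0 < ρ := by positivity
  set C := cthickening ρ Q with hCdef
  have hC : IsCompact C := hQ.cthickening
  have hC2 : cthickening ρ C ⊆ O := (cthickening_cthickening_subset hρ.le hρ.le Q).trans
    (by rw [hρdef, add_halves]; exact hρO)
  have hCO : C ⊆ O := (self_subset_cthickening C).trans hC2
  have hQC : Q ⊆ C := self_subset_cthickening Q
  have hball : ∀ y ∈ Q, ∀ z, dist z y ≤ ρ → z ∈ C := fun y hy z hz =>
    mem_cthickening_of_dist_le z y ρ Q hy hz
  refine eInt_le_of_trunc hu hC hCO (measure_mono_null (compl_subset_compl.2 hQC) hδQ)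
    (measure_mono_null (compl_subset_compl.2 hQC) hωQ) fun n => ?_
  have husc := (trunc_usc hu n).mono hCO
  obtain ⟨M, hM⟩ := exists_abs_indicator_trunc_le hu hC hCO n
  obtain ⟨B, hB⟩ := hC.isBounded.exists_norm_le
  refine integral_le_of_potential_le hd hQ (O := O) hδQ hωQ
    (husc.measurable_indicator hC.measurableSet) (R := B + 1) hM
    (fun y hy => ?_) hρ (fun y hy s hs hsρ => ?_) (fun y hy => ?_) (fun x hx s hs hsρ => ?_) ?_ ?_
  · have : y ∈ C := by
      by_contra h
      exact hy (indicator_of_notMem h _)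
    linarith [hB y this]
  · have h1 := trunc_le_sphInt hd hu n hs (x := y)
      fun z hz => hCO (hball y hy z ((mem_closedBall.1 hz).trans hsρ.le))
    have h2 : ∀ ζ : sphere (0 : Euc d) 1, C.indicator (trunc u n) (y + s • (ζ : Euc d))
        = trunc u n (y + s • (ζ : Euc d)) := fun ζ => indicator_of_mem
      (hball y hy _ (by rw [dist_add_smul_sphere y ζ hs.le]; exact hsρ.le)) _
    rw [indicator_of_mem (hQC hy)]
    simpa only [sphInt, h2] using h1
  · have hnhds : C ∈ 𝓝 y := Filter.mem_of_superset (closedBall_mem_nhds y hρ) fun z hz =>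
      hball y hy z hz
    intro a ha
    rw [indicator_of_mem (hQC hy)] at ha
    have h1 := husc y (hQC hy) a ha
    rw [nhdsWithin_eq_nhds.2 hnhds] at h1
    filter_upwards [h1, hnhds] with z hz hzC
    rwa [indicator_of_mem hzC]
  · have h1 : ∀ ζ : sphere (0 : Euc d) 1, C.indicator (trunc u n) (x + s • (ζ : Euc d)) = 0 := by
      intro ζ
      refine indicator_of_notMem (fun hc => hx (hC2 ?_)) _
      refine mem_cthickening_of_dist_le x _ ρ C hc ?_
      rw [dist_comm, dist_add_smul_sphere x ζ hs.le]
      exact hsρ.le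
    rw [indicator_of_notMem fun hc => hx (hCO hc)]
    simp [sphInt, h1]
  · filter_upwards [eInt_Kker_ae hd hQ hδQ, eInt_Kker_ae hd hQ hωQ] with x h1 h2 hx
    have := hle x hx
    rwa [h1.2, h2.2, EReal.coe_le_coe_iff] at this
  · filter_upwards [eInt_Kker_ae hd hQ hδQ, eInt_Kker_ae hd hQ hωQ] with x h1 h2 hx
    have := heq x ⟨hx.1, fun h => hx.2 (Or.inl h)⟩
    rwa [h1.2, h2.2, EReal.coe_eq_coe_iff] at this

/-- On a point, every subharmonic function is identically `-∞`. -/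
lemma eq_bot_of_sbhOn_zero {O : Set (Euc 0)} {u : Euc 0 → EReal} (hu : SbhOn u O) {x : Euc 0}
    (hx : x ∈ O) : u x = ⊥ := by
  have hO : O = univ := eq_univ_of_forall fun y => Subsingleton.elim x y ▸ hx
  have hs : ∀ y : Euc 0, y ∉ sphere x 1 := fun y hy => by
    rw [mem_sphere, Subsingleton.elim y x, dist_self] at hy
    exact zero_ne_one hy
  refine EReal.eq_bot_iff_forall_lt _ |>.2 fun a => ?_
  refine lt_of_le_of_lt ?_ (EReal.coe_lt_coe_iff.2 (sub_one_lt a))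
  refine hu.2.2 x 1 one_pos (hO ▸ subset_univ _) (fun _ => a - 1) continuousOn_const
    ⟨continuousOn_const, fun y r hr _ => ?_⟩ (fun y hy => absurd hy (hs y)) x
    (mem_closedBall_self zero_le_one)
  rw [setAverage_const (measure_closedBall_pos volume y hr).ne' measure_closedBall_lt_top.ne]

lemma Kker_zero (y x : Euc 0) : Kker 0 y x = ⊥ := by
  simp [Kker, Subsingleton.elim y x]

/-- Let `δ, ω` be finite positive Borel measures with compact support in an
open set `O ⊆ ℝ^d`. Then `ω` is an `sbh(O)`-balayage of `δ`, i.e. `∫ u dδ ≤ ∫ u dω` for every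
`u` subharmonic on `O`, if and only if there is a compact set `S ⋐ O` such that
`∫ K_{d-2}(y,x) dδ(y) ≤ ∫ K_{d-2}(y,x) dω(y)` for every `x ∈ O`, with equality for
every `x ∈ O \ S`. -/
theorem stmt_10 {d : ℕ} (O : Set (Euc d)) (hO : IsOpen O) (hOne : O.Nonempty)
    (δ ω : Measure (Euc d)) (hδ : MeasCompIn δ O) (hω : MeasCompIn ω O) :
    (∀ u : Euc d → EReal, SbhOn u O → eInt δ u ≤ eInt ω u) ↔
      ∃ S : Set (Euc d), IsCompact S ∧ S ⊆ O ∧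
        (∀ x ∈ O, eInt δ (fun y => Kker d y x) ≤ eInt ω (fun y => Kker d y x)) ∧
        (∀ x ∈ O \ S, eInt δ (fun y => Kker d y x) = eInt ω (fun y => Kker d y x)) := by
  rcases Nat.eq_zero_or_pos d with rfl | hd
  · have hK : ∀ x : Euc 0, (fun y => Kker 0 y x) = fun _ => ⊥ := fun x => funext fun y => Kker_zero y x
    simp only [hK]
    obtain ⟨x₀, hx₀⟩ := hOne
    constructor
    · intro h
      have hbot : SbhOn (fun _ : Euc 0 => (⊥ : EReal)) O :=
        ⟨upperSemicontinuousOn_const, fun _ _ => bot_lt_top, fun _ _ _ _ _ _ _ _ _ _ => bot_le⟩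
      exact ⟨O, O.toFinite.isCompact, Subset.rfl, fun _ _ => h _ hbot, fun x hx => absurd hx.1 hx.2⟩
    · rintro ⟨S, -, -, hle, -⟩ u hu
      have hu' : u = fun _ => ⊥ := funext fun y =>
        eq_bot_of_sbhOn_zero hu (Subsingleton.elim x₀ y ▸ hx₀)
      rw [hu']
      exact hle x₀ hx₀
  · refine ⟨exists_compact_of_balayage hd hO hδ hω, ?_⟩
    rintro ⟨S, hS, hSO, hle, heq⟩ u hu
    exact balayage_of_potential_le hd hO hδ hω hS hSO hle heq hu
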